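/- arXiv:1009.5339 — 2 statements merged into one kernel-verified Lean document; each statement's English description precedes it below -/
import Mathlib

section
/- Let q be a prime power and F_q the finite field with q elements. The number of isomorphism classes of 3-dimensional nilpotent non-unital associative F_q-algebras is q + 6 if q is odd, and q + 5 if q is even. -/
/-- A nilpotent (non-unital) associative algebra structure on the `F`-vector space
`Fin n → F`: a bilinear, associative multiplication such that for some `m ≥ 1` every
product of `m` elements is zero. -/
structure NilpAlgStr (F : Type*) [Field F] (n : ℕ) where
  mul : (Fin n → F) →ₗ[F] (Fin n → F) →ₗ[F] (Fin n → F)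
  assoc : ∀ x y z, mul (mul x y) z = mul x (mul y z)
  nilpotent : ∃ m : ℕ, 0 < m ∧ ∀ (x : Fin n → F) (l : List (Fin n → F)),
      l.length + 1 = m → l.foldl (fun p q => mul p q) x = 0

/-- Two algebra structures are isomorphic when some linear automorphism intertwines
the multiplications. -/
def NilpAlgStr.Iso {F : Type*} [Field F] {n : ℕ} (P Q : NilpAlgStr F n) : Prop :=
  ∃ e : (Fin n → F) ≃ₗ[F] (Fin n → F), ∀ x y, e (P.mul x y) = Q.mul (e x) (e y)


namespace Nil3

open Module

variable {F : Type} [Field F]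

abbrev V (F : Type) := Fin 3 → F

lemma iso_refl {n : ℕ} (P : NilpAlgStr F n) : P.Iso P := ⟨LinearEquiv.refl _ _, fun _ _ => rfl⟩

lemma iso_symm {n : ℕ} {P Q : NilpAlgStr F n} (h : P.Iso Q) : Q.Iso P := by
  obtain ⟨e, he⟩ := h
  refine ⟨e.symm, fun x y => ?_⟩
  apply e.injective
  rw [he]; simp

lemma iso_trans {n : ℕ} {P Q R : NilpAlgStr F n} (h : P.Iso Q) (h' : Q.Iso R) : P.Iso R := by
  obtain ⟨e, he⟩ := h
  obtain ⟨f, hf⟩ := h'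
  exact ⟨e.trans f, fun x y => by simp [he, hf]⟩

lemma iso_equiv (n : ℕ) : Equivalence (@NilpAlgStr.Iso F _ n) :=
  ⟨iso_refl, iso_symm, iso_trans⟩

lemma iso_of_inj {P Q : NilpAlgStr F 3} (f : V F →ₗ[F] V F) (hf : ∀ x, f x = 0 → x = 0)
    (h : ∀ x y, f (P.mul x y) = Q.mul (f x) (f y)) : P.Iso Q := by
  have hi : Function.Injective f := (injective_iff_map_eq_zero f).2 hf
  exact ⟨LinearEquiv.ofInjectiveEndo f hi, fun x y => by simpa using h x y⟩

/-- bilinear form algebra -/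
def bil (a b c d : F) : NilpAlgStr F 3 where
  mul := LinearMap.mk₂ F
    (fun x y => ![0, 0, a * (x 0 * y 0) + b * (x 0 * y 1) + c * (x 1 * y 0) + d * (x 1 * y 1)])
    (by intro x x' y; ext i; fin_cases i <;> simp; ring)
    (by intro r x y; ext i; fin_cases i <;> simp; ring)
    (by intro x x' y; ext i; fin_cases i <;> simp; ring)
    (by intro r x y; ext i; fin_cases i <;> simp; ring)
  assoc := by intro x y z; ext i; fin_cases i <;> simp
  nilpotent := by
    refine ⟨3, by norm_num, ?_⟩
    intro x l hl
    match l, hl with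
    | [y, z], _ => ext i; fin_cases i <;> simp

lemma bil_mul (a b c d : F) (x y : V F) : (bil a b c d).mul x y =
    ![0, 0, a * (x 0 * y 0) + b * (x 0 * y 1) + c * (x 1 * y 0) + d * (x 1 * y 1)] := rfl

/-- the truncated polynomial algebra -/
def chain (F : Type) [Field F] : NilpAlgStr F 3 where
  mul := LinearMap.mk₂ F
    (fun x y => ![0, x 0 * y 0, x 0 * y 1 + x 1 * y 0])
    (by intro x x' y; ext i; fin_cases i <;> simp <;> ring)
    (by intro r x y; ext i; fin_cases i <;> simp <;> ring)
    (by intro x x' y; ext i; fin_cases i <;> simp <;> ring)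
    (by intro r x y; ext i; fin_cases i <;> simp <;> ring)
  assoc := by intro x y z; ext i; fin_cases i <;> simp; ring
  nilpotent := by
    refine ⟨4, by norm_num, ?_⟩
    intro x l hl
    match l, hl with
    | [y, z, w], _ => ext i; fin_cases i <;> simp

lemma chain_mul (x y : V F) : (chain F).mul x y = ![0, x 0 * y 0, x 0 * y 1 + x 1 * y 0] := rfl

/-- sufficient condition for isomorphism -/
lemma iso_bil {a b c d a' b' c' d' : F} (p q r s l : F) (hl : l ≠ 0) (hD : p * s - q * r ≠ 0)
    (h1 : l * a = a' * (p * p) + b' * (p * r) + c' * (r * p) + d' * (r * r))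
    (h2 : l * b = a' * (p * q) + b' * (p * s) + c' * (r * q) + d' * (r * s))
    (h3 : l * c = a' * (q * p) + b' * (q * r) + c' * (s * p) + d' * (s * r))
    (h4 : l * d = a' * (q * q) + b' * (q * s) + c' * (s * q) + d' * (s * s)) :
    (bil a b c d).Iso (bil a' b' c' d') := by
  let f : V F →ₗ[F] V F :=
    { toFun := fun x => ![p * x 0 + q * x 1, r * x 0 + s * x 1, l * x 2]
      map_add' := by intro x y; ext i; fin_cases i <;> simp <;> ring
      map_smul' := by intro x y; ext i; fin_cases i <;> simp <;> ring }
  have hf : ∀ x, f x = ![p * x 0 + q * x 1, r * x 0 + s * x 1, l * x 2] := fun _ => rfl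
  refine iso_of_inj f ?_ ?_
  · intro x hx
    rw [hf] at hx
    have e0 : p * x 0 + q * x 1 = 0 := congrFun hx 0
    have e1 : r * x 0 + s * x 1 = 0 := congrFun hx 1
    have e2 : l * x 2 = 0 := congrFun hx 2
    have z2 : x 2 = 0 := by simpa [hl] using e2
    have z0 : x 0 = 0 := by
      have : (p * s - q * r) * x 0 = 0 := by linear_combination s * e0 - q * e1
      simpa [hD] using this
    have z1 : x 1 = 0 := by
      have : (p * s - q * r) * x 1 = 0 := by linear_combination p * e1 - r * e0
      simpa [hD] using this
    ext i; fin_cases i <;> simp [z0, z1, z2]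
  · intro x y
    rw [hf, bil_mul, bil_mul, hf, hf]
    ext i; fin_cases i
    · simp
    · simp
    · simp
      linear_combination (x 0 * y 0) * h1 + (x 0 * y 1) * h2 + (x 1 * y 0) * h3 + (x 1 * y 1) * h4

lemma bil_inv {a b c d a' b' c' d' : F} (h : (bil a b c d).Iso (bil a' b' c' d'))
    (hne : ¬ (a = 0 ∧ b = 0 ∧ c = 0 ∧ d = 0)) :
    ∃ l D : F, l ≠ 0 ∧ D ≠ 0 ∧ l ^ 2 * (a * d - b * c) = D ^ 2 * (a' * d' - b' * c') ∧
      l * (b - c) = D * (b' - c') ∧ (a' = 0 → d' = 0 → b' + c' = 0 → a = 0) := by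
  obtain ⟨e, he⟩ := h
  have key : ∀ i j : Fin 3, e ((bil a b c d).mul (Pi.single i 1) (Pi.single j 1)) =
    (bil a' b' c' d').mul (e (Pi.single i 1)) (e (Pi.single j 1)) := fun i j => he _ _
  set u := e (Pi.single 0 1) with hu
  set v := e (Pi.single 1 1) with hv
  set w := e (Pi.single 2 1) with hw
  have hs : ∀ t : F, e ![0, 0, t] = t • w := by
    intro t
    rw [hw, ← map_smul]; congr 1
    ext i; fin_cases i <;> simp
  have h00 : a • w = (bil a' b' c' d').mul u u := by
    rw [← hs, hu, ← key]; congr 1; simp [bil_mul]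
  have h01 : b • w = (bil a' b' c' d').mul u v := by
    rw [← hs, hu, hv, ← key]; congr 1; simp [bil_mul]
  have h10 : c • w = (bil a' b' c' d').mul v u := by
    rw [← hs, hu, hv, ← key]; congr 1; simp [bil_mul]
  have h11 : d • w = (bil a' b' c' d').mul v v := by
    rw [← hs, hv, ← key]; congr 1; simp [bil_mul]
  rw [bil_mul] at h00 h01 h10 h11
  have z : ∀ i : Fin 3, i ≠ 2 → w i = 0 := by
    intro i hi
    have g : ∀ t s : F, t • w = ![0, 0, s] → t = 0 ∨ w i = 0 := by
      intro t s ht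
      have := congrFun ht i
      fin_cases i <;> simp at this hi ⊢ <;> exact this
    by_contra hc
    exact hne ⟨(g _ _ h00).resolve_right hc, (g _ _ h01).resolve_right hc,
      (g _ _ h10).resolve_right hc, (g _ _ h11).resolve_right hc⟩
  have w0 := z 0 (by decide)
  have w1 := z 1 (by decide)
  have hlin : ∀ x y t : F, e ![x, y, t] = x • u + y • v + t • w := by
    intro x y t
    rw [hu, hv, hw, ← map_smul, ← map_smul, ← map_smul, ← map_add, ← map_add]; congr 1
    ext i; fin_cases i <;> simp
  have hl : w 2 ≠ 0 := by
    intro h2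
    have : w = 0 := by ext i; fin_cases i <;> simp [w0, w1, h2]
    rw [hw, map_eq_zero_iff e e.injective] at this
    have := congrFun this 2
    simp at this
  have hD : u 0 * v 1 - v 0 * u 1 ≠ 0 := by
    intro h0
    have comb : ∀ x y : F, x * u 0 + y * v 0 = 0 → x * u 1 + y * v 1 = 0 → x = 0 ∧ y = 0 := by
      intro x y hx hy
      have : e ![x, y, -(x * u 2 + y * v 2) / w 2] = 0 := by
        rw [hlin]
        ext i; fin_cases i
        · simp [w0, hx]
        · simp [w1, hy]
        · simp; field_simp; ring
      rw [map_eq_zero_iff e e.injective] at this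
      exact ⟨congrFun this 0, congrFun this 1⟩
    have c1 := comb (v 1) (-u 1) (by linear_combination h0) (by ring)
    have c2 := comb (v 0) (-u 0) (by ring) (by linear_combination -h0)
    have c3 := comb 1 0 (by simpa using c2.2) (by simpa using c1.2)
    exact one_ne_zero c3.1
  have k1 := congrFun h00 2
  have k2 := congrFun h01 2
  have k3 := congrFun h10 2
  have k4 := congrFun h11 2
  simp at k1 k2 k3 k4
  refine ⟨w 2, u 0 * v 1 - v 0 * u 1, hl, hD, ?_, ?_, ?_⟩
  · have : w 2 ^ 2 * (a * d - b * c) = (a * w 2) * (d * w 2) - (b * w 2) * (c * w 2) := by ring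
    rw [this, k1, k2, k3, k4]; ring
  · linear_combination k2 - k3
  · intro ha hd hbc
    have : a * w 2 = 0 := by
      rw [k1, ha, hd]; linear_combination (u 0 * u 1) * hbc
    simpa [hl] using this

lemma zero_inv {a b c d : F} (h : (bil 0 0 0 0).Iso (bil a b c d)) :
    a = 0 ∧ b = 0 ∧ c = 0 ∧ d = 0 := by
  obtain ⟨e, he⟩ := h
  have : ∀ x y, (bil a b c d).mul x y = 0 := by
    intro x y
    have := he (e.symm x) (e.symm y)
    simp only [LinearEquiv.apply_symm_apply] at this
    rw [← this, bil_mul]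
    convert map_zero e
    ext i; fin_cases i <;> simp
  have g : ∀ i j : Fin 3, (bil a b c d).mul (Pi.single i 1) (Pi.single j 1) 2 = 0 := by
    intro i j; rw [this]; rfl
  refine ⟨?_, ?_, ?_, ?_⟩
  · simpa [bil_mul] using g 0 0
  · simpa [bil_mul] using g 0 1
  · simpa [bil_mul] using g 1 0
  · simpa [bil_mul] using g 1 1

lemma chain_inv {a b c d : F} (h : (chain F).Iso (bil a b c d)) : False := by
  obtain ⟨e, he⟩ := h
  let x : V F := Pi.single 0 1
  have h1 : e ((chain F).mul ((chain F).mul x x) x) = 0 := by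
    rw [he, he]
    ext i; fin_cases i <;> simp [bil_mul]
  rw [map_eq_zero_iff e e.injective] at h1
  have := congrFun h1 2
  simp [chain_mul, x] at this

/-- normal forms -/
def nf (n : F) : F ⊕ Fin 6 → NilpAlgStr F 3
  | Sum.inl t => bil 1 0 1 t
  | Sum.inr 0 => chain F
  | Sum.inr 1 => bil 0 0 0 0
  | Sum.inr 2 => bil 0 1 (-1) 0
  | Sum.inr 3 => bil 1 0 0 0
  | Sum.inr 4 => bil 1 0 0 1
  | Sum.inr 5 => bil 1 0 0 n

lemma nf_inj_aux (n : F) (i j : F ⊕ Fin 6) (hi : i = Sum.inr 5 → ¬ IsSquare n)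
    (hj : j = Sum.inr 5 → ¬ IsSquare n) (h : (nf n i).Iso (nf n j)) : i = j := by
  have hs := iso_symm h
  have sq : ∀ l D x : F, l ≠ 0 → l ^ 2 * x = D ^ 2 → IsSquare x := by
    intro l D x hl hx
    refine ⟨D / l, ?_⟩
    field_simp
    linear_combination hx
  have nz : ¬ IsSquare n → n ≠ 0 := by
    rintro h rfl
    exact h ⟨0, by simp⟩
  rcases i with t | i <;> rcases j with t' | j
  · obtain ⟨l, D, hl, hD, h1, h2, h3⟩ := bil_inv h (by simp)
    have : l = D := by linear_combination -h2
    subst this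
    have : t = t' := by
      simpa [hl] using h1
    rw [this]
  · exfalso
    fin_cases j
    · exact chain_inv hs
    · have := zero_inv hs
      simp at this
    · obtain ⟨l, D, hl, hD, h1, h2, h3⟩ := bil_inv h (by simp)
      simp at h3
    all_goals
      obtain ⟨l, D, hl, hD, h1, h2, h3⟩ := bil_inv h (by simp)
      simp [hl] at h2
  · exfalso
    fin_cases i
    · exact chain_inv h
    · have := zero_inv h
      simp at this
    · obtain ⟨l, D, hl, hD, h1, h2, h3⟩ := bil_inv hs (by simp)
      simp at h3
    all_goals
      obtain ⟨l, D, hl, hD, h1, h2, h3⟩ := bil_inv hs (by simp)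
      simp [hl] at h2
  · fin_cases i <;> fin_cases j <;> first | rfl | exfalso
    all_goals first
      | exact chain_inv h
      | exact chain_inv hs
      | (have := zero_inv h; simp at this; done)
      | (have := zero_inv hs; simp at this; done)
      | skip
    all_goals
      obtain ⟨l, D, hl, hD, h1, h2, h3⟩ := bil_inv h (by simp)
      obtain ⟨l', D', hl', hD', h1', h2', h3'⟩ := bil_inv hs (by simp)
    all_goals first
      | (simp at h3; done)
      | (simp at h3'; done)
      | (simp [hl, hD] at h1; done)
      | (simp [hl', hD'] at h1'; done)
      | (have hn := hi rfl; have hn0 := nz hn; simp [hl, hD, hn0] at h1; done)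
      | (have hn := hj rfl; have hn0 := nz hn; simp [hl, hD, hn0] at h1; done)
      | (have hn := hi rfl; exact hn (sq l D n hl (by linear_combination h1)))
      | (have hn := hj rfl; exact hn (sq l' D' n hl' (by linear_combination h1')))

lemma bil_class (n : F) (hn : ∀ x : F, x ≠ 0 → IsSquare x ∨ (¬ IsSquare n ∧ IsSquare (x / n)))
    (a b c d : F) : ∃ i, (i = Sum.inr 5 → ¬ IsSquare n) ∧ (bil a b c d).Iso (nf n i) := by
  by_cases halt : a = 0 ∧ d = 0 ∧ b + c = 0
  · obtain ⟨rfl, rfl, hbc⟩ := halt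
    have hc : c = -b := by linear_combination hbc
    subst hc
    by_cases hb : b = 0
    · subst hb
      refine ⟨Sum.inr 1, by simp, ?_⟩
      simpa [nf] using iso_refl (bil (0 : F) 0 0 0)
    · refine ⟨Sum.inr 2, by simp, ?_⟩
      refine iso_bil 1 0 0 1 b⁻¹ (by simpa using hb) (by simp) ?_ ?_ ?_ ?_ <;> simp [hb]
  · obtain ⟨v0, v1, hv⟩ : ∃ v0 v1 : F,
        a * (v0 * v0) + b * (v0 * v1) + c * (v1 * v0) + d * (v1 * v1) ≠ 0 := by
      by_contra! hcon
      have e1 := hcon 1 0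
      have e2 := hcon 0 1
      have e3 := hcon 1 1
      simp at e1 e2 e3
      exact halt ⟨e1, e2, by simpa [e1, e2] using e3⟩
    obtain ⟨c', d', h1⟩ : ∃ c' d', (bil a b c d).Iso (bil 1 0 c' d') := by
      set l := a * (v0 * v0) + b * (v0 * v1) + c * (v1 * v0) + d * (v1 * v1) with hl
      set w0 := -(b * v0 + d * v1) with hw0
      set w1 := a * v0 + c * v1 with hw1
      refine ⟨(a * (w0 * v0) + b * (w0 * v1) + c * (w1 * v0) + d * (w1 * v1)) / l,
        (a * (w0 * w0) + b * (w0 * w1) + c * (w1 * w0) + d * (w1 * w1)) / l, iso_symm ?_⟩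
      refine iso_bil v0 w0 v1 w1 l hv ?_ ?_ ?_ ?_ ?_
      · convert hv using 1
        rw [hw0, hw1, hl]; ring
      · rw [hl]; ring
      · rw [hw0, hw1]; ring
      · field_simp
      · field_simp
    by_cases hc : c' = 0
    · subst hc
      by_cases hd : d' = 0
      · subst hd
        exact ⟨Sum.inr 3, by simp, h1⟩
      · rcases hn d' hd with ⟨s, hs⟩ | ⟨hns, s, hs⟩
        · refine ⟨Sum.inr 4, by simp, iso_trans h1 ?_⟩
          have : s ≠ 0 := by rintro rfl; simp at hs; exact hd hs
          refine iso_bil 1 0 0 s 1 one_ne_zero (by simpa using this) ?_ ?_ ?_ ?_ <;> simp [hs]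
        · refine ⟨Sum.inr 5, fun _ => hns, iso_trans h1 ?_⟩
          have hn0 : n ≠ 0 := by rintro rfl; exact hns ⟨0, by simp⟩
          have hs' : d' = n * (s * s) := by rw [← hs]; field_simp
          have : s ≠ 0 := by rintro rfl; simp at hs'; exact hd hs'
          refine iso_bil 1 0 0 s 1 one_ne_zero (by simpa using this) ?_ ?_ ?_ ?_ <;> simp [hs']
    · refine ⟨Sum.inl (d' / c' ^ 2), by simp, iso_trans h1 ?_⟩
      refine iso_bil 1 0 0 c' 1 one_ne_zero (by simpa using hc) ?_ ?_ ?_ ?_ <;> simp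
      field_simp

/-- lower central-like series -/
def S (P : NilpAlgStr F 3) : ℕ → Submodule F (V F)
  | 0 => ⊤
  | k + 1 => Submodule.map₂ P.mul (S P k) ⊤

variable (P : NilpAlgStr F 3)

lemma S_anti (k : ℕ) : S P (k + 1) ≤ S P k := by
  induction k with
  | zero => exact le_top
  | succ k ih => exact Submodule.map₂_le_map₂_left ih

lemma S_span (k : ℕ) : S P k ≤ Submodule.span F
    {z | ∃ x, ∃ l : List (V F), l.length = k ∧ l.foldl (fun p q => P.mul p q) x = z} := by
  induction k with
  | zero =>
    intro z _
    exact Submodule.subset_span ⟨z, [], rfl, rfl⟩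
  | succ k ih =>
    refine (Submodule.map₂_le_map₂_left ih).trans ?_
    rw [← Submodule.span_univ, Submodule.map₂_span_span]
    apply Submodule.span_mono
    rintro _ ⟨_, ⟨x, l, hl, rfl⟩, y, _, rfl⟩
    exact ⟨x, l ++ [y], by simp [hl], by simp⟩

lemma S_bot : ∃ k, S P k = ⊥ := by
  obtain ⟨m, hm, h⟩ := P.nilpotent
  refine ⟨m - 1, ?_⟩
  rw [eq_bot_iff]
  refine (S_span P _).trans ?_
  rw [Submodule.span_le]
  rintro _ ⟨x, l, hl, rfl⟩
  exact h x l (by omega)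

lemma S_stab {k : ℕ} (h : S P (k + 1) = S P k) : S P k = ⊥ := by
  have : ∀ j, S P (k + j) = S P k := by
    intro j
    induction j with
    | zero => rfl
    | succ j ih =>
      change Submodule.map₂ P.mul (S P (k + j)) ⊤ = _
      rw [ih]; exact h
  obtain ⟨m, hm⟩ := S_bot P
  have anti : Antitone (S P) := antitone_nat_of_succ_le (S_anti P)
  rw [eq_bot_iff, ← this m, ← hm]
  exact anti (by omega)

lemma S_rank (k : ℕ) : S P k = ⊥ ∨ finrank F (S P (k + 1)) < finrank F (S P k) := by
  by_cases h : S P (k + 1) = S P k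
  · exact Or.inl (S_stab P h)
  · exact Or.inr (Submodule.finrank_lt_finrank_of_lt (lt_of_le_of_ne (S_anti P k) h))

lemma S0_rank : finrank F (S P 0) = 3 := by
  change finrank F (⊤ : Submodule F (V F)) = 3
  simp

lemma S1_rank : finrank F (S P 1) ≤ 2 := by
  rcases S_rank P 0 with h | h
  · have := S0_rank P
    rw [h] at this; simp at this
  · rw [S0_rank, zero_add] at h; omega

lemma mul_mem (k : ℕ) {x : V F} (hx : x ∈ S P k) (y : V F) : P.mul x y ∈ S P (k + 1) :=
  Submodule.apply_mem_map₂ _ hx trivial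

lemma mul_memL (k : ℕ) (x : V F) : ∀ {y : V F}, y ∈ S P k → P.mul x y ∈ S P (k + 1) := by
  induction k with
  | zero => intro y _; exact mul_mem P 0 trivial y
  | succ k ih =>
    intro y hy
    have : S P (k + 1) ≤ (S P (k + 2)).comap (P.mul x) := by
      refine Submodule.map₂_le.2 fun u hu v _ => ?_
      rw [Submodule.mem_comap, ← P.assoc]
      exact mul_mem P (k + 1) (ih hu) _
    exact this hy

lemma exists_gen (h : finrank F (S P 1) = 2) :
    ∃ a, S P 1 ≤ Submodule.span F {P.mul a a} ⊔ S P 2 := by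
  have hne : S P 1 ≠ ⊤ := by
    intro ht; rw [ht] at h; simp at h
  obtain ⟨a, ha⟩ : ∃ a, a ∉ S P 1 := by
    by_contra! hc
    exact hne (eq_top_iff.2 fun x _ => hc x)
  refine ⟨a, ?_⟩
  have ht : Submodule.span F {a} ⊔ S P 1 = ⊤ := by
    have hlt : S P 1 < Submodule.span F {a} ⊔ S P 1 := by
      refine lt_of_le_of_ne le_sup_right fun he => ha ?_
      rw [he]
      exact Submodule.mem_sup_left (Submodule.mem_span_singleton_self a)
    have := Submodule.finrank_lt_finrank_of_lt hlt
    apply Submodule.eq_top_of_finrank_eq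
    have h3 := Submodule.finrank_le (Submodule.span F {a} ⊔ S P 1)
    simp only [finrank_fintype_fun_eq_card, Fintype.card_fin] at h3 ⊢
    omega
  have dec : ∀ x : V F, ∃ t : F, ∃ s ∈ S P 1, x = t • a + s := by
    intro x
    have : x ∈ Submodule.span F {a} ⊔ S P 1 := by rw [ht]; trivial
    obtain ⟨y, hy, s, hs, rfl⟩ := Submodule.mem_sup.1 this
    obtain ⟨t, rfl⟩ := Submodule.mem_span_singleton.1 hy
    exact ⟨t, s, hs, rfl⟩
  refine Submodule.map₂_le.2 fun x _ y _ => ?_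
  obtain ⟨t, s, hs, rfl⟩ := dec x
  obtain ⟨t', s', hs', rfl⟩ := dec y
  have : P.mul (t • a + s) (t' • a + s') =
      (t * t') • P.mul a a + (t • P.mul a s' + P.mul s (t' • a + s')) := by
    simp [smul_smul]
    module
  rw [this]
  refine Submodule.add_mem_sup (Submodule.smul_mem _ _ (Submodule.mem_span_singleton_self _))
    (add_mem (Submodule.smul_mem _ _ (mul_memL P 1 _ hs')) (mul_mem P 1 hs _))

lemma case_chain (h : S P 2 ≠ ⊥) : P.Iso (chain F) := by
  have r2 : finrank F (S P 2) ≠ 0 := by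
    rwa [Ne, Submodule.finrank_eq_zero]
  have r1 := S1_rank P
  have h1 : S P 1 ≠ ⊥ := by
    intro hb; exact h (by rw [eq_bot_iff, ← hb]; exact S_anti P 1)
  have l1 := (S_rank P 1).resolve_left h1
  have l2 := (S_rank P 2).resolve_left h
  have h3 : S P 3 = ⊥ := by
    rw [← Submodule.finrank_eq_zero (R := F)]
    simp only [Nat.reduceAdd] at l1 l2
    omega
  obtain ⟨a, ha⟩ := exists_gen P (by simp only [Nat.reduceAdd] at l1 l2; omega)
  have z4 : ∀ x ∈ S P 2, ∀ y, P.mul x y = 0 := by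
    intro x hx y
    have := mul_mem P 2 hx y
    simpa [h3] using this
  set b := P.mul a a with hb
  set c := P.mul b a with hc
  have hc' : P.mul a b = c := by rw [hc, hb, P.assoc]
  have hb1 : b ∈ S P 1 := mul_mem P 0 trivial _
  have hc2 : c ∈ S P 2 := mul_mem P 1 hb1 _
  have hca : ∀ y, P.mul c y = 0 := z4 c hc2
  have hbb : P.mul b b = 0 := by
    have : P.mul c a = P.mul b b := by rw [hc, P.assoc]
    rw [← this, hca]
  have z4' : ∀ x ∈ S P 2, ∀ y, P.mul y x = 0 := by
    intro x hx y
    have := mul_memL P 2 y hx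
    simpa [h3] using this
  have hac : ∀ y, P.mul y c = 0 := z4' c hc2
  have dec : ∀ x ∈ S P 1, ∃ t : F, ∃ s ∈ S P 2, x = t • b + s := by
    intro x hx
    obtain ⟨y, hy, s, hs, rfl⟩ := Submodule.mem_sup.1 (ha hx)
    obtain ⟨t, rfl⟩ := Submodule.mem_span_singleton.1 hy
    exact ⟨t, s, hs, rfl⟩
  have hc0 : c ≠ 0 := by
    intro h0
    apply h
    rw [eq_bot_iff]
    refine Submodule.map₂_le.2 fun x hx y _ => ?_
    obtain ⟨t, s, hs, rfl⟩ := dec x hx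
    obtain ⟨t', s', hs', hay⟩ := dec (P.mul a y) (mul_mem P 0 trivial _)
    have : P.mul b y = 0 := by
      rw [hb, P.assoc, hay]
      simp [hc', h0, z4' s' hs']
    simp [this, z4 s hs]
  let f : V F →ₗ[F] V F :=
    { toFun := fun x => x 0 • a + x 1 • b + x 2 • c
      map_add' := by intro x y; simp only [Pi.add_apply]; module
      map_smul' := by intro x y; simp only [Pi.smul_apply, smul_eq_mul, RingHom.id_apply]; module }
  have hf : ∀ x, f x = x 0 • a + x 1 • b + x 2 • c := fun _ => rfl
  have hfm : ∀ x y, P.mul (f x) (f y) = (x 0 * y 0) • b + (x 0 * y 1 + x 1 * y 0) • c := by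
    intro x y
    rw [hf, hf]
    simp only [map_add, map_smul, LinearMap.add_apply, LinearMap.smul_apply, ← hb, ← hc, hc', hbb,
      hca, hac]
    module
  refine iso_symm (iso_of_inj f ?_ ?_)
  · intro x hx
    have e1 : P.mul (P.mul (f x) a) a = 0 := by rw [hx]; simp
    rw [hf] at e1
    simp only [map_add, map_smul, LinearMap.add_apply, LinearMap.smul_apply, ← hb, ← hc, hca] at e1
    have x0 : x 0 = 0 := by simpa [hc0] using e1
    have e2 : P.mul (f x) a = 0 := by rw [hx]; simp
    rw [hf] at e2
    simp only [map_add, map_smul, LinearMap.add_apply, LinearMap.smul_apply, ← hb, ← hc, hca] at e2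
    have x1 : x 1 = 0 := by simpa [hc0, x0] using e2
    rw [hf] at hx
    have x2 : x 2 = 0 := by simpa [hc0, x0, x1] using hx
    ext i; fin_cases i <;> simp [x0, x1, x2]
  · intro x y
    rw [hfm, chain_mul, hf]
    simp

lemma exists_move (c : V F) (hc : c ≠ 0) : ∃ e : V F ≃ₗ[F] V F, e c = Pi.single 2 1 := by
  have key : ∀ c : V F, c 2 ≠ 0 → ∃ e : V F ≃ₗ[F] V F, e c = Pi.single 2 1 := by
    intro c h2
    let f : V F →ₗ[F] V F :=
      { toFun := fun x => ![x 0 - x 2 * (c 0 / c 2), x 1 - x 2 * (c 1 / c 2), x 2 / c 2]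
        map_add' := by intro x y; ext i; fin_cases i <;> simp <;> ring
        map_smul' := by intro x y; ext i; fin_cases i <;> simp <;> ring }
    have hf : ∀ x, f x = ![x 0 - x 2 * (c 0 / c 2), x 1 - x 2 * (c 1 / c 2), x 2 / c 2] :=
      fun _ => rfl
    have hi : Function.Injective f := by
      refine (injective_iff_map_eq_zero f).2 fun x hx => ?_
      rw [hf] at hx
      have e0 : x 0 - x 2 * (c 0 / c 2) = 0 := congrFun hx 0
      have e1 : x 1 - x 2 * (c 1 / c 2) = 0 := congrFun hx 1
      have e2 : x 2 / c 2 = 0 := congrFun hx 2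
      have z2 : x 2 = 0 := by simpa [h2] using e2
      have z0 : x 0 = 0 := by simpa [z2] using e0
      have z1 : x 1 = 0 := by simpa [z2] using e1
      ext i; fin_cases i <;> simp [z0, z1, z2]
    refine ⟨LinearEquiv.ofInjectiveEndo f hi, ?_⟩
    rw [LinearEquiv.coe_ofInjectiveEndo, hf]
    ext i; fin_cases i <;> simp [h2] <;> field_simp <;> simp
  obtain ⟨i, hi⟩ : ∃ i, c i ≠ 0 := by
    by_contra! h; exact hc (funext h)
  let s : V F ≃ₗ[F] V F := LinearEquiv.funCongrLeft F F (Equiv.swap i 2)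
  obtain ⟨e, he⟩ := key (s c) (by simpa [s, LinearEquiv.funCongrLeft, LinearMap.funLeft] using hi)
  exact ⟨s.trans e, he⟩

lemma case_bil (h : S P 2 = ⊥) : ∃ a b c d, P.Iso (bil a b c d) := by
  have r1 : finrank F (S P 1) ≤ 1 := by
    by_contra hr
    have h2 := S1_rank P
    obtain ⟨a, ha⟩ := exists_gen P (by omega)
    rw [h, sup_bot_eq] at ha
    have h3 : Set.finrank F ({P.mul a a} : Set (V F)) ≤ 1 := by
      simpa using finrank_span_finset_le_card (R := F) ({P.mul a a} : Finset (V F))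
    exact hr ((Submodule.finrank_mono ha).trans h3)
  obtain ⟨z, hz0, hz, hl, hr⟩ : ∃ z : V F, z ≠ 0 ∧ S P 1 ≤ Submodule.span F {z} ∧
      (∀ y, P.mul z y = 0) ∧ ∀ y, P.mul y z = 0 := by
    by_cases hb : S P 1 = ⊥
    · refine ⟨Pi.single 2 1, by simp, by simp [hb], fun y => ?_, fun y => ?_⟩
      · have := mul_mem P 0 (x := Pi.single 2 1) trivial y
        simpa [hb] using this
      · have := mul_mem P 0 (x := y) trivial (Pi.single 2 1)
        simpa [hb] using this
    · obtain ⟨z, hz, hz0⟩ := Submodule.exists_mem_ne_zero_of_ne_bot hb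
      refine ⟨z, hz0, ?_, fun y => ?_, fun y => ?_⟩
      · have hle : Submodule.span F {z} ≤ S P 1 := by
          rw [Submodule.span_singleton_le_iff_mem]; exact hz
        refine (Submodule.eq_of_le_of_finrank_le hle ?_).ge
        rw [finrank_span_singleton hz0]; exact r1
      · have := mul_mem P 1 hz y
        simpa [h] using this
      · have := mul_memL P 1 y hz
        simpa [h] using this
  obtain ⟨e, he⟩ := exists_move z hz0
  have ht : ∀ x y, ∃ t : F, t • z = P.mul x y := fun x y =>
    Submodule.mem_span_singleton.1 (hz (mul_mem P 0 trivial y))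
  set u := e.symm (Pi.single 0 1) with hu
  set v := e.symm (Pi.single 1 1) with hv
  have hz' : z = e.symm (Pi.single 2 1) := by rw [← he]; simp
  obtain ⟨a, h00⟩ := ht u u
  obtain ⟨b, h01⟩ := ht u v
  obtain ⟨c, h10⟩ := ht v u
  obtain ⟨d, h11⟩ := ht v v
  have hx : ∀ x, x = e x 0 • u + e x 1 • v + e x 2 • z := by
    intro x
    apply e.injective
    simp only [map_add, map_smul, hu, hv, he, LinearEquiv.apply_symm_apply]
    ext i; fin_cases i <;> simp
  refine ⟨a, b, c, d, e, fun x y => ?_⟩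
  have : P.mul x y = (a * (e x 0 * e y 0) + b * (e x 0 * e y 1) + c * (e x 1 * e y 0)
      + d * (e x 1 * e y 1)) • z := by
    conv_lhs => rw [hx x, hx y]
    simp only [map_add, map_smul, LinearMap.add_apply, LinearMap.smul_apply, hl, hr, ← h00, ← h01,
      ← h10, ← h11]
    module
  rw [this, bil_mul, map_smul, he]
  ext i; fin_cases i <;> simp

lemma nf_surj (n : F) (hn : ∀ x : F, x ≠ 0 → IsSquare x ∨ (¬ IsSquare n ∧ IsSquare (x / n))) :
    ∃ i, (i = Sum.inr 5 → ¬ IsSquare n) ∧ P.Iso (nf n i) := by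
  by_cases h : S P 2 = ⊥
  · obtain ⟨a, b, c, d, h⟩ := case_bil P h
    obtain ⟨i, hi, h'⟩ := bil_class n hn a b c d
    exact ⟨i, hi, iso_trans h h'⟩
  · exact ⟨Sum.inr 0, by simp, case_chain P h⟩

lemma count {n : F} (hn : ∀ x : F, x ≠ 0 → IsSquare x ∨ (¬ IsSquare n ∧ IsSquare (x / n))) :
    Nat.card (Quot (@NilpAlgStr.Iso F _ 3)) =
      Nat.card {i : F ⊕ Fin 6 // i = Sum.inr 5 → ¬ IsSquare n} := by
  symm
  refine Nat.card_congr (Equiv.ofBijective (fun i => Quot.mk _ (nf n i.1)) ⟨?_, ?_⟩)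
  · intro i j hij
    have := (iso_equiv 3).eqvGen_iff.1 (Quot.eqvGen_exact hij)
    exact Subtype.ext (nf_inj_aux n i.1 j.1 i.2 j.2 this)
  · intro x
    obtain ⟨P, rfl⟩ := Quot.exists_rep x
    obtain ⟨i, hi, h⟩ := nf_surj P n hn
    exact ⟨⟨i, hi⟩, Quot.sound (iso_symm h)⟩

end Nil3

/-- Over the finite field with `q` elements, the number of isomorphism classes of
3-dimensional nilpotent non-unital associative algebras is `q + 6` if `q` is odd and
`q + 5` if `q` is even. -/
theorem stmt12 (F : Type) [Field F] [Fintype F] :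
    (Odd (Fintype.card F) →
      Nat.card (Quot (@NilpAlgStr.Iso F _ 3)) = Fintype.card F + 6) ∧
    (Even (Fintype.card F) →
      Nat.card (Quot (@NilpAlgStr.Iso F _ 3)) = Fintype.card F + 5) := by
  classical
  constructor
  · intro hodd
    have hF : ringChar F ≠ 2 := by
      intro h
      have := FiniteField.even_card_iff_char_two.1 h
      have := Nat.odd_iff.1 hodd
      omega
    obtain ⟨n, hn⟩ := FiniteField.exists_nonsquare hF
    have hn0 : n ≠ 0 := by rintro rfl; exact hn ⟨0, by simp⟩
    rw [Nil3.count (n := n)]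
    · simp [hn]
    · intro x hx
      by_cases hs : IsSquare x
      · exact Or.inl hs
      · refine Or.inr ⟨hn, ?_⟩
        rw [← quadraticChar_neg_one_iff_not_isSquare] at hs hn
        have h1 : IsSquare (x * n) := by
          rw [← quadraticChar_one_iff_isSquare (mul_ne_zero hx hn0), map_mul, hs, hn]; rfl
        obtain ⟨r, hr⟩ := h1
        exact ⟨r / n, by field_simp; linear_combination hr⟩
  · intro heven
    have hF : ringChar F = 2 := FiniteField.even_card_iff_char_two.2 (Nat.even_iff.1 heven)
    have hsq := FiniteField.isSquare_of_char_two hF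
    rw [Nil3.count (n := (1 : F)) (fun x _ => Or.inl (hsq x))]
    have h1 : ¬ ¬ IsSquare (1 : F) := not_not.2 (hsq 1)
    simp only [h1, imp_false]
    rw [Nat.card_eq_fintype_card, Fintype.card_subtype_compl]
    simp
end

section
/- Over the field ℝ of real numbers there are exactly 12 isomorphism classes of 4-dimensional commutative nilpotent non-unital associative algebras; over any finite field (of odd or of even characteristic) there are exactly 11 isomorphism classes of 4-dimensional commutative nilpotent non-unital associative algebras. -/
/-- A commutative nilpotent (non-unital) associative algebra structure on the
`F`-vector space `Fin n → F`: a bilinear, commutative, associative multiplication such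
that for some `m ≥ 1` every product of `m` elements is zero. -/
structure CommNilpAlgStr (F : Type*) [Field F] (n : ℕ) where
  mul : (Fin n → F) →ₗ[F] (Fin n → F) →ₗ[F] (Fin n → F)
  comm : ∀ x y, mul x y = mul y x
  assoc : ∀ x y z, mul (mul x y) z = mul x (mul y z)
  nilpotent : ∃ m : ℕ, 0 < m ∧ ∀ (x : Fin n → F) (l : List (Fin n → F)),
      l.length + 1 = m → l.foldl (fun p q => mul p q) x = 0

/-- Two algebra structures are isomorphic when some linear automorphism intertwines
the multiplications. -/
def CommNilpAlgStr.Iso {F : Type*} [Field F] {n : ℕ}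
    (P Q : CommNilpAlgStr F n) : Prop :=
  ∃ e : (Fin n → F) ≃ₗ[F] (Fin n → F), ∀ x y, e (P.mul x y) = Q.mul (e x) (e y)

namespace NilAlg

section Basic
variable {F : Type*} [Field F] {A : Type*} [AddCommGroup A] [Module F A]

def LI4 (F : Type*) [Field F] {A : Type*} [AddCommGroup A] [Module F A] (x y z w : A) : Prop :=
  ∀ a b c d : F, a • x + b • y + c • z + d • w = 0 → a = 0 ∧ b = 0 ∧ c = 0 ∧ d = 0

theorem LI4.li {x y z w : A} (h : LI4 F x y z w) : LinearIndependent F ![x, y, z, w] := by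
  rw [Fintype.linearIndependent_iff]
  intro g hg
  rw [Fin.sum_univ_four] at hg
  obtain ⟨h0, h1, h2, h3⟩ := h _ _ _ _ hg
  intro i
  fin_cases i <;> assumption

noncomputable def LI4.basis (hd : Module.finrank F A = 4) {x y z w : A} (h : LI4 F x y z w) :
    Module.Basis (Fin 4) F A :=
  basisOfLinearIndependentOfCardEqFinrank h.li (by simp [hd])

theorem LI4.coe_basis (hd : Module.finrank F A = 4) {x y z w : A} (h : LI4 F x y z w) :
    (h.basis hd : Fin 4 → A) = ![x, y, z, w] := by
  simp [LI4.basis]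

theorem LI4.span (hd : Module.finrank F A = 4) {x y z w : A} (h : LI4 F x y z w) (t : A) :
    ∃ a b c d : F, t = a • x + b • y + c • z + d • w := by
  have := (h.basis hd).sum_repr t
  rw [Fin.sum_univ_four, h.coe_basis hd] at this
  exact ⟨_, _, _, _, this.symm⟩

theorem exists_out (hd : Module.finrank F A = 4) (x y z : A) :
    ∃ w : A, ∀ a b c : F, w ≠ a • x + b • y + c • z := by
  classical
  have h1 : Module.finrank F (Submodule.span F (Set.range ![x, y, z])) ≤ 3 := by
    exact finrank_range_le_card (R := F) ![x, y, z]
  have h2 : Submodule.span F (Set.range ![x, y, z]) ≠ ⊤ := by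
    intro h
    rw [h, finrank_top, hd] at h1
    omega
  obtain ⟨w, hw⟩ : ∃ w, w ∉ Submodule.span F (Set.range ![x, y, z]) := by
    by_contra! hc
    exact h2 (Submodule.eq_top_iff'.2 hc)
  refine ⟨w, fun a b c h => hw ?_⟩
  rw [h]
  refine add_mem (add_mem ?_ ?_) ?_ <;> apply Submodule.smul_mem <;> apply Submodule.subset_span
  · exact ⟨0, rfl⟩
  · exact ⟨1, rfl⟩
  · exact ⟨2, rfl⟩

theorem ext3 (hd : Module.finrank F A = 4) (x y z : A)
    (h : ∀ a b c : F, a • x + b • y + c • z = 0 → a = 0 ∧ b = 0 ∧ c = 0) :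
    ∃ w, LI4 F x y z w := by
  obtain ⟨w, hw⟩ := exists_out hd x y z
  refine ⟨w, fun a b c d e => ?_⟩
  by_cases hd0 : d = 0
  · subst hd0
    obtain ⟨h1, h2, h3⟩ := h a b c (by simpa using e)
    exact ⟨h1, h2, h3, rfl⟩
  · exfalso
    apply hw (-(d⁻¹ * a)) (-(d⁻¹ * b)) (-(d⁻¹ * c))
    have : w = d⁻¹ • (d • w) := by rw [smul_smul, inv_mul_cancel₀ hd0, one_smul]
    rw [this, eq_neg_of_add_eq_zero_right e]
    module

theorem ext2 (hd : Module.finrank F A = 4) (x y : A)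
    (h : ∀ a b : F, a • x + b • y = 0 → a = 0 ∧ b = 0) :
    ∃ z w, LI4 F x y z w := by
  obtain ⟨w, hw⟩ := exists_out hd x y 0
  refine ⟨w, ext3 hd x y w fun a b d e => ?_⟩
  by_cases hd0 : d = 0
  · subst hd0
    obtain ⟨h1, h2⟩ := h a b (by simpa using e)
    exact ⟨h1, h2, rfl⟩
  · exfalso
    apply hw (-(d⁻¹ * a)) (-(d⁻¹ * b)) 0
    have : w = d⁻¹ • (d • w) := by rw [smul_smul, inv_mul_cancel₀ hd0, one_smul]
    rw [this, eq_neg_of_add_eq_zero_right e]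
    module

end Basic

section Alg
variable {F : Type*} [Field F]

def Alg (_P : CommNilpAlgStr F 4) : Type _ := Fin 4 → F

variable (P : CommNilpAlgStr F 4)

instance : AddCommGroup (Alg P) := inferInstanceAs (AddCommGroup (Fin 4 → F))
instance : Module F (Alg P) := inferInstanceAs (Module F (Fin 4 → F))

instance : NonUnitalCommRing (Alg P) :=
  { (inferInstance : AddCommGroup (Alg P)) with
    mul := fun x y => P.mul x y
    left_distrib := fun x y z => (P.mul x).map_add y z
    right_distrib := LinearMap.map_add₂ P.mul
    zero_mul := LinearMap.map_zero₂ P.mul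
    mul_zero := fun x => (P.mul x).map_zero
    mul_assoc := P.assoc
    mul_comm := P.comm }

theorem mul_def (x y : Alg P) : x * y = P.mul x y := rfl

instance : IsScalarTower F (Alg P) (Alg P) := ⟨LinearMap.map_smul₂ P.mul⟩

instance : SMulCommClass F (Alg P) (Alg P) := ⟨fun a x y => ((P.mul x).map_smul a y).symm⟩

theorem alg_finrank : Module.finrank F (Alg P) = 4 := by
  change Module.finrank F (Fin 4 → F) = 4
  simp

theorem nil_aux (p u : Fin 4 → F) (h : p = P.mul p u) : p = 0 := by
  obtain ⟨m, hm, H⟩ := P.nilpotent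
  have h2 : ∀ k, (List.replicate k u).foldl (fun p q => P.mul p q) p = p := by
    intro k
    induction k with
    | zero => rfl
    | succ k ih => rw [List.replicate_succ, List.foldl_cons, ← h, ih]
  rw [← h2 (m - 1)]
  exact H _ _ (by simp; omega)

theorem alg_nil (p u : Alg P) (h : p = p * u) : p = 0 := nil_aux P p u h

theorem iso_of_basis (Q : CommNilpAlgStr F 4) (b : Module.Basis (Fin 4) F (Alg P))
    (h : ∀ i j, b i * b j = ∑ k, Q.mul (Pi.single i 1) (Pi.single j 1) k • b k) : P.Iso Q := by
  refine ⟨b.equivFun, ?_⟩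
  have key : (LinearMap.compr₂ P.mul b.equivFun.toLinearMap : Alg P →ₗ[F] Alg P →ₗ[F] (Fin 4 → F)) =
      (Q.mul.compl₁₂ b.equivFun.toLinearMap b.equivFun.toLinearMap) := by
    refine LinearMap.ext_basis b b fun i j => ?_
    change b.equivFun (b i * b j) = Q.mul (b.equivFun (b i)) (b.equivFun (b j))
    rw [h, map_sum]
    have hs : ∀ i, b.equivFun (b i) = Pi.single i 1 := by
      intro i
      ext k
      simp [Pi.single_apply, eq_comm]
    simp only [map_smul, hs]
    ext k
    simp [Finset.sum_apply, Pi.single_apply]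
  intro x y
  exact congrArg (fun f => f x y) key

end Alg


section Fam
variable {F : Type*} [Field F]

def famA (a b c d : F) : CommNilpAlgStr F 4 where
  mul := LinearMap.mk₂ F (fun x y => ![0, 0, 0,
      a * x 0 * y 0 + b * (x 0 * y 1 + x 1 * y 0) + c * x 1 * y 1 + d * x 2 * y 2])
    (by intro x y z; ext i; fin_cases i <;> simp; ring)
    (by intro r x y; ext i; fin_cases i <;> simp; ring)
    (by intro x y z; ext i; fin_cases i <;> simp; ring)
    (by intro r x y; ext i; fin_cases i <;> simp; ring)
  comm x y := by ext i; fin_cases i <;> simp; ring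
  assoc x y z := by ext i; fin_cases i <;> simp
  nilpotent := by
    refine ⟨3, by norm_num, fun x l hl => ?_⟩
    match l, hl with
    | [p, q], _ => ext i; fin_cases i <;> simp

theorem famA_mul (a b c d : F) (x y : Fin 4 → F) : (famA a b c d).mul x y = ![0, 0, 0,
      a * x 0 * y 0 + b * (x 0 * y 1 + x 1 * y 0) + c * x 1 * y 1 + d * x 2 * y 2] := rfl

def famB (a b c : F) : CommNilpAlgStr F 4 where
  mul := LinearMap.mk₂ F (fun x y => ![0, 0,
      a * x 0 * y 0 + c * (x 0 * y 1 + x 1 * y 0), b * x 0 * y 0 + x 1 * y 1])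
    (by intro x y z; ext i; fin_cases i <;> simp <;> ring)
    (by intro r x y; ext i; fin_cases i <;> simp <;> ring)
    (by intro x y z; ext i; fin_cases i <;> simp <;> ring)
    (by intro r x y; ext i; fin_cases i <;> simp <;> ring)
  comm x y := by ext i; fin_cases i <;> simp <;> ring
  assoc x y z := by ext i; fin_cases i <;> simp
  nilpotent := by
    refine ⟨3, by norm_num, fun x l hl => ?_⟩
    match l, hl with
    | [p, q], _ => ext i; fin_cases i <;> simp

theorem famB_mul (a b c : F) (x y : Fin 4 → F) : (famB a b c).mul x y = ![0, 0,
      a * x 0 * y 0 + c * (x 0 * y 1 + x 1 * y 0), b * x 0 * y 0 + x 1 * y 1] := rfl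

def famC (d : F) : CommNilpAlgStr F 4 where
  mul := LinearMap.mk₂ F (fun x y => ![0, 0, x 0 * y 0, x 0 * y 2 + x 2 * y 0 + d * x 1 * y 1])
    (by intro x y z; ext i; fin_cases i <;> simp <;> ring)
    (by intro r x y; ext i; fin_cases i <;> simp <;> ring)
    (by intro x y z; ext i; fin_cases i <;> simp <;> ring)
    (by intro r x y; ext i; fin_cases i <;> simp <;> ring)
  comm x y := by ext i; fin_cases i <;> simp <;> ring
  assoc x y z := by ext i; fin_cases i <;> simp; ring
  nilpotent := by
    refine ⟨4, by norm_num, fun x l hl => ?_⟩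
    match l, hl with
    | [p, q, r], _ => ext i; fin_cases i <;> simp

theorem famC_mul (d : F) (x y : Fin 4 → F) : (famC d).mul x y =
    ![0, 0, x 0 * y 0, x 0 * y 2 + x 2 * y 0 + d * x 1 * y 1] := rfl

def famD (F : Type*) [Field F] : CommNilpAlgStr F 4 where
  mul := LinearMap.mk₂ F (fun x y => ![0, x 0 * y 0, x 0 * y 1 + x 1 * y 0,
      x 0 * y 2 + x 2 * y 0 + x 1 * y 1])
    (by intro x y z; ext i; fin_cases i <;> simp <;> ring)
    (by intro r x y; ext i; fin_cases i <;> simp <;> ring)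
    (by intro x y z; ext i; fin_cases i <;> simp <;> ring)
    (by intro r x y; ext i; fin_cases i <;> simp <;> ring)
  comm x y := by ext i; fin_cases i <;> simp <;> ring
  assoc x y z := by ext i; fin_cases i <;> simp <;> ring
  nilpotent := by
    refine ⟨5, by norm_num, fun x l hl => ?_⟩
    match l, hl with
    | [p, q, r, s], _ => ext i; fin_cases i <;> simp

theorem famD_mul (x y : Fin 4 → F) : (famD F).mul x y = ![0, x 0 * y 0, x 0 * y 1 + x 1 * y 0,
      x 0 * y 2 + x 2 * y 0 + x 1 * y 1] := rfl

def HasA {F : Type*} [Field F] (A : Type*) [NonUnitalCommRing A] [Module F A] (a b c d : F) : Prop :=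
  ∃ x y z v : A, LI4 F x y z v ∧ x * x = a • v ∧ x * y = b • v ∧ y * y = c • v ∧ z * z = d • v ∧
    x * z = 0 ∧ y * z = 0 ∧ ∀ t, v * t = 0

def HasB {F : Type*} [Field F] (A : Type*) [NonUnitalCommRing A] [Module F A] (a b c : F) : Prop :=
  ∃ x y u w : A, LI4 F x y u w ∧ x * x = a • u + b • w ∧ x * y = c • u ∧ y * y = w ∧
    (∀ t, u * t = 0) ∧ ∀ t, w * t = 0

def HasC {F : Type*} [Field F] (A : Type*) [NonUnitalCommRing A] [Module F A] (d : F) : Prop :=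
  ∃ x y : A, LI4 F x y (x * x) (x * x * x) ∧ x * y = 0 ∧ y * y = d • (x * x * x) ∧
    ∀ t, x * x * x * t = 0

def HasD (F : Type*) [Field F] (A : Type*) [NonUnitalCommRing A] [Module F A] : Prop :=
  ∃ x : A, LI4 F x (x * x) (x * x * x) (x * x * x * x) ∧ ∀ t, x * x * x * x * t = 0

variable {P : CommNilpAlgStr F 4}

theorem HasA.iso {a b c d : F} (h : HasA (Alg P) a b c d) : P.Iso (famA a b c d) := by
  obtain ⟨x, y, z, v, hl, h1, h2, h3, h4, h5, h6, h7⟩ := h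
  have h2' := mul_comm x y ▸ h2
  have h5' := mul_comm x z ▸ h5
  have h6' := mul_comm y z ▸ h6
  have h7' : ∀ t, t * v = 0 := fun t => mul_comm v t ▸ h7 t
  refine iso_of_basis P _ (hl.basis (alg_finrank P)) ?_
  rw [hl.coe_basis]
  intro i j
  rw [Fin.sum_univ_four]
  fin_cases i <;> fin_cases j <;> simp [famA_mul, *]

theorem HasB.iso {a b c : F} (h : HasB (Alg P) a b c) : P.Iso (famB a b c) := by
  obtain ⟨x, y, u, w, hl, h1, h2, h3, h4, h5⟩ := h
  have h2' := mul_comm x y ▸ h2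
  have h4' : ∀ t, t * u = 0 := fun t => mul_comm u t ▸ h4 t
  have h5' : ∀ t, t * w = 0 := fun t => mul_comm w t ▸ h5 t
  refine iso_of_basis P _ (hl.basis (alg_finrank P)) ?_
  rw [hl.coe_basis]
  intro i j
  rw [Fin.sum_univ_four]
  fin_cases i <;> fin_cases j <;> simp [famB_mul, *]

theorem HasC.iso {d : F} (h : HasC (Alg P) d) : P.Iso (famC d) := by
  obtain ⟨x, y, hl, h1, h2, h3⟩ := h
  have h1' := mul_comm x y ▸ h1
  have h3' : ∀ t, t * (x * x * x) = 0 := fun t => mul_comm (x * x * x) t ▸ h3 t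
  have h4 : x * x * (x * x) = 0 := by rw [← mul_assoc, h3]
  have h5 : x * x * y = 0 := by rw [mul_assoc, h1, mul_zero]
  have h5' : y * (x * x) = 0 := by rw [mul_comm, h5]
  have h6 : x * (x * x) = x * x * x := (mul_assoc x x x).symm
  refine iso_of_basis P _ (hl.basis (alg_finrank P)) ?_
  rw [hl.coe_basis]
  intro i j
  rw [Fin.sum_univ_four]
  fin_cases i <;> fin_cases j <;> simp [famC_mul, *]

theorem HasD.iso (h : HasD F (Alg P)) : P.Iso (famD F) := by
  obtain ⟨x, hl, h3⟩ := h
  have h3' : ∀ t, t * (x * x * x * x) = 0 := fun t => mul_comm (x * x * x * x) t ▸ h3 t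
  have e1 : x * (x * x) = x * x * x := (mul_assoc x x x).symm
  have e2 : x * (x * x * x) = x * x * x * x := mul_comm _ _
  have e3 : x * x * (x * x) = x * x * x * x := (mul_assoc _ x x).symm
  have e4 : x * x * (x * x * x) = 0 := by rw [mul_comm, ← mul_assoc, h3]
  have e5 : x * x * x * (x * x) = 0 := by rw [← mul_assoc, h3]
  have e6 : x * x * x * (x * x * x) = 0 := by rw [← mul_assoc, ← mul_assoc, h3, zero_mul]
  refine iso_of_basis P _ (hl.basis (alg_finrank P)) ?_
  rw [hl.coe_basis]
  intro i j
  rw [Fin.sum_univ_four]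
  fin_cases i <;> fin_cases j <;> simp [famD_mul, *]

end Fam


set_option linter.all false
set_option linter.unusedSimpArgs false
set_option linter.unusedSectionVars false
section Class
variable {F : Type*} [Field F] {A : Type*} [NonUnitalCommRing A] [Module F A]
  [IsScalarTower F A A] [SMulCommClass F A A]

theorem nil_smul (hnil : ∀ p u : A, p = p * u → p = 0) {a : F} {p u : A} (h : a • p = p * u)
    (hp : p ≠ 0) : a = 0 := by
  by_contra ha
  apply hp
  apply hnil p (a⁻¹ • u)
  rw [mul_smul_comm, ← h, smul_smul, inv_mul_cancel₀ ha, one_smul]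

theorem caseD (hd : Module.finrank F A = 4) (hnil : ∀ p u : A, p = p * u → p = 0)
    (h : ∃ x y z w : A, x * y * z * w ≠ 0) : HasD F A := by
  obtain ⟨x, y, z, w, h⟩ := h
  have chain : ∀ y z w : A, x * y * z * w ≠ 0 → LI4 F x (x * y) (x * y * z) (x * y * z * w) := by
    intro y z w h a b c d e
    have h3 : x * y * z ≠ 0 := fun h' => h (by rw [h', zero_mul])
    have h2 : x * y ≠ 0 := fun h' => h3 (by rw [h', zero_mul])
    have h1 : x ≠ 0 := fun h' => h2 (by rw [h', zero_mul])
    have a0 : a = 0 := nil_smul hnil (u := -(b • y + c • (y * z) + d • (y * z * w))) (by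
      simp only [mul_neg, mul_add, mul_smul_comm, ← mul_assoc]
      linear_combination (norm := module) e) h1
    subst a0
    have b0 : b = 0 := nil_smul hnil (u := -(c • z + d • (z * w))) (by
      simp only [mul_neg, mul_add, mul_smul_comm, ← mul_assoc]
      linear_combination (norm := module) e) h2
    subst b0
    have c0 : c = 0 := nil_smul hnil (u := -(d • w)) (by
      simp only [mul_neg, mul_add, mul_smul_comm, ← mul_assoc]
      linear_combination (norm := module) e) h3
    subst c0
    refine ⟨rfl, rfl, rfl, ?_⟩
    simpa [h] using e
  have hb := chain y z w h
  have key : ∀ t : A, ∃ (a : F) (s : A), t = a • x + x * s := by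
    intro t
    obtain ⟨a, b, c, d, e⟩ := hb.span hd t
    refine ⟨a, b • y + c • (y * z) + d • (y * z * w), ?_⟩
    rw [e]
    simp only [mul_add, mul_smul_comm, ← mul_assoc]
    module
  have key2 : ∀ q t : A, q * x = 0 → q * t = 0 := by
    intro q t h
    obtain ⟨a, s, rfl⟩ := key t
    rw [mul_add, mul_smul_comm, ← mul_assoc, h]
    simp
  have hx4 : x * x * x * x ≠ 0 := by
    intro h0
    apply h
    have e1 := key2 (x * x * x) w h0
    have e2 := key2 (x * x * w) z (by rw [mul_right_comm, e1])
    have e3 := key2 (x * w * z) y (by rw [← e2]; ac_rfl)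
    rw [← e3]; ac_rfl
  have hb2 := chain x x x hx4
  refine ⟨x, hb2, ?_⟩
  have h3 : x * x * x ≠ 0 := fun h' => hx4 (by rw [h', zero_mul])
  have h2 : x * x ≠ 0 := fun h' => h3 (by rw [h', zero_mul])
  have h1 : x ≠ 0 := fun h' => h2 (by rw [h', zero_mul])
  intro t
  obtain ⟨a, b, c, d, e⟩ := hb2.span hd (x * x * x * x * t)
  have a0 : a = 0 := nil_smul hnil
    (u := x * x * x * t - (b • x + c • (x * x) + d • (x * x * x))) (by
      simp only [mul_sub, mul_add, mul_smul_comm, ← mul_assoc]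
      linear_combination (norm := module) -e) h1
  subst a0
  have b0 : b = 0 := nil_smul hnil
    (u := x * x * t - (c • x + d • (x * x))) (by
      simp only [mul_sub, mul_add, mul_smul_comm, ← mul_assoc]
      linear_combination (norm := module) -e) h2
  subst b0
  have c0 : c = 0 := nil_smul hnil
    (u := x * t - (d • x)) (by
      simp only [mul_sub, mul_add, mul_smul_comm, ← mul_assoc]
      linear_combination (norm := module) -e) h3
  subst c0
  have d0 : d = 0 := nil_smul hnil (u := t) (by
      linear_combination (norm := module) -e) hx4
  subst d0
  simpa using e

theorem caseC (hd : Module.finrank F A = 4) (hnil : ∀ p u : A, p = p * u → p = 0)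
    (h4 : ∀ x y z w : A, x * y * z * w = 0)
    (h : ∃ x y z : A, x * y * z ≠ 0) : HasC A (0 : F) ∨ HasC A (1 : F) := by
  have chain : ∀ x y z : A, x * y * z ≠ 0 → ∀ a b c : F,
      a • x + b • (x * y) + c • (x * y * z) = 0 → a = 0 ∧ b = 0 ∧ c = 0 := by
    intro x y z h3 a b c e
    have h2 : x * y ≠ 0 := fun h' => h3 (by rw [h', zero_mul])
    have h1 : x ≠ 0 := fun h' => h2 (by rw [h', zero_mul])
    have a0 : a = 0 := nil_smul hnil (u := -(b • y + c • (y * z))) (by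
      simp only [mul_neg, mul_add, mul_smul_comm, ← mul_assoc]
      linear_combination (norm := module) e) h1
    subst a0
    have b0 : b = 0 := nil_smul hnil (u := -(c • z)) (by
      simp only [mul_neg, mul_smul_comm]
      linear_combination (norm := module) e) h2
    subst b0
    refine ⟨rfl, rfl, ?_⟩
    simpa [h3] using e
  have sq : ∀ x y : A, x * x * y ≠ 0 → x * x * x ≠ 0 := by
    intro x y hxy h0
    have hl : LI4 F x (x * x) (x * x * y) y := by
      intro a b c d e
      by_cases hd0 : d = 0
      · subst hd0
        obtain ⟨h1, h2, h3⟩ := chain x x y hxy a b c (by simpa using e)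
        exact ⟨h1, h2, h3, rfl⟩
      · exfalso
        have := congrArg (fun t => x * x * t) e
        simp only [mul_add, mul_smul_comm, ← mul_assoc, h0, h4, smul_zero, zero_add, mul_zero, zero_mul,
          add_zero, smul_eq_zero] at this
        tauto
    obtain ⟨a, b, c, d, e⟩ := hl.span hd (x * y)
    have e1 : x * x * y = a • (x * x) + d • (x * y) := by
      have := congrArg (fun t => x * t) e
      simpa only [mul_add, mul_smul_comm, ← mul_assoc, h0, h4, smul_zero, zero_add, mul_zero, zero_mul,
          add_zero] using this
    have e2 : d • (x * x * y) = 0 := by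
      have := congrArg (fun t => x * t) e1
      simp only [mul_add, mul_smul_comm, ← mul_assoc, h0, h4, smul_zero, zero_add, zero_mul] at this
      exact this.symm
    have d0 : d = 0 := by
      rw [smul_eq_zero] at e2; tauto
    subst d0
    have e3 : a • (x * x * y) = 0 := by
      have := congrArg (fun t => t * y) e1
      simp only [smul_mul_assoc, add_mul, h4, zero_smul, add_zero] at this
      exact this.symm
    have a0 : a = 0 := by
      rw [smul_eq_zero] at e3; tauto
    subst a0
    apply hxy
    rw [e1]; simp
  obtain ⟨x, hx⟩ : ∃ x : A, x * x * x ≠ 0 := by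
    by_contra! hc
    have hc2 : ∀ x y : A, x * x * y = 0 := by
      intro x y
      by_contra hh
      exact sq x y hh (hc x)
    obtain ⟨p, q, r, h⟩ := h
    have hl : LI4 F p (p * q) (p * q * r) q := by
      intro a b c d e
      by_cases hd0 : d = 0
      · subst hd0
        obtain ⟨h1, h2, h3⟩ := chain p q r h a b c (by simpa using e)
        exact ⟨h1, h2, h3, rfl⟩
      · exfalso
        have := congrArg (fun t => p * r * t) e
        simp only [mul_add, mul_smul_comm, ← mul_assoc, h4, smul_zero, mul_zero, zero_mul,
          add_zero] at this
        rw [mul_right_comm p r p, hc2, mul_right_comm p r q, smul_zero, zero_add,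
          smul_eq_zero] at this
        tauto
    obtain ⟨a, b, c, d, e⟩ := hl.span hd r
    apply h
    rw [e]
    simp only [mul_add, mul_smul_comm, ← mul_assoc, h4, zero_mul, smul_zero, add_zero]
    rw [mul_right_comm p q p, hc2, mul_assoc p q q, mul_comm p, hc2]
    simp
  obtain ⟨y, hy⟩ := ext3 hd _ _ _ (chain x x x hx)
  obtain ⟨a, c, d, b, e⟩ := hy.span hd (x * y)
  have b0 : b = 0 := by
    by_contra hb
    have e1 : x * x * y = a • (x * x) + c • (x * x * x) + b • (x * y) := by
      have := congrArg (fun t => x * t) e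
      simpa only [mul_add, mul_smul_comm, ← mul_assoc, h4, smul_zero, zero_add, mul_zero, zero_mul,
          add_zero] using this
    have e2 : 0 = a • (x * x * x) + b • (x * x * y) := by
      have := congrArg (fun t => x * t) e1
      simpa only [mul_add, mul_smul_comm, ← mul_assoc, h4, smul_zero, zero_add, mul_zero, zero_mul,
          add_zero] using this
    have := (hy (b ^ 2 * a) (b ^ 2 * c + a * b) (b ^ 2 * d + b * c + a) (b ^ 3) (by
      linear_combination (norm := module) -(b ^ 2) • e - b • e1 - e2)).2.2.2
    exact hb (by simpa using this)
  subst b0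
  have a0 : a = 0 := by
    have := congrArg (fun t => x * x * t) e
    simp only [mul_add, mul_smul_comm, ← mul_assoc, h4, smul_zero, zero_add, mul_zero, zero_mul, zero_smul,
          add_zero] at this
    have := this.symm
    rw [smul_eq_zero] at this
    tauto
  subst a0
  obtain ⟨z, hz⟩ : ∃ z, z = y - c • x - d • (x * x) := ⟨_, rfl⟩
  have hxz : x * z = 0 := by
    rw [hz]
    simp only [mul_sub, mul_smul_comm, ← mul_assoc]
    linear_combination (norm := module) e
  have hl : LI4 F x z (x * x) (x * x * x) := by
    intro k l m n e
    rw [hz] at e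
    obtain ⟨h1, h2, h3, h4⟩ := hy (k - l * c) (m - l * d) n l (by
      linear_combination (norm := module) e)
    subst h4
    simp at h1 h2
    exact ⟨h1, rfl, h2, h3⟩
  obtain ⟨p, q, r, s, f⟩ := hl.span hd (z * z)
  have f1 : p • (x * x) + r • (x * x * x) = 0 := by
    have := congrArg (fun t => x * t) f
    simp only [mul_add, mul_smul_comm, ← mul_assoc, h4, hxz, smul_zero, zero_add, mul_zero, zero_mul,
          add_zero] at this
    exact this.symm
  obtain ⟨-, p0, r0⟩ := chain x x x hx 0 p r (by simpa using f1)
  subst p0 r0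
  have q0 : q = 0 := by
    by_contra hq
    have f2 : q • (z * z) = z * z * z := by
      have := congrArg (fun t => z * t) f
      simp only [mul_add, mul_smul_comm, mul_comm z (x * x * x), h4, smul_zero, zero_smul, zero_add,
          add_zero] at this
      rw [← this, mul_assoc]
    have : z * z = 0 := by
      by_contra hzz
      exact hq (nil_smul hnil f2 hzz)
    rw [this] at f
    have := (hl 0 q 0 s (by linear_combination (norm := module) -f)).2.1
    exact hq this
  subst q0
  have f' : z * z = s • (x * x * x) := by rw [f]; simp
  by_cases hs : s = 0
  · left
    refine ⟨x, z, hl, hxz, by rw [f', hs], fun t => h4 _ _ _ _⟩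
  · right
    refine ⟨s • x, s • z, ?_, ?_, ?_, fun t => h4 _ _ _ _⟩
    · intro k l m n e
      simp only [smul_mul_assoc, mul_smul_comm, smul_smul] at e
      obtain ⟨h1, h2, h3, h4⟩ := hl _ _ _ _ e
      simp only [mul_eq_zero, hs, or_false, or_self] at h1 h2 h3 h4
      exact ⟨h1, h2, h3, h4⟩
    · simp only [smul_mul_assoc, mul_smul_comm, hxz, smul_zero]
    · simp only [smul_mul_assoc, mul_smul_comm, f', smul_smul]
      module


theorem LI4.smul {x y z w : A} (h : LI4 F x y z w) {p q r s : F} (hp : p ≠ 0) (hq : q ≠ 0)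
    (hr : r ≠ 0) (hs : s ≠ 0) : LI4 F (p • x) (q • y) (r • z) (s • w) := by
  intro a b c d e
  simp only [smul_smul] at e
  obtain ⟨h1, h2, h3, h4⟩ := h _ _ _ _ e
  simp only [mul_eq_zero, hp, hq, hr, hs, or_false] at h1 h2 h3 h4
  exact ⟨h1, h2, h3, h4⟩

def Iso2 (c : F) : Prop := ∃ p0 p1 q0 q1 : F, p0 ^ 2 + c * p1 ^ 2 = 0 ∧ q0 ^ 2 + c * q1 ^ 2 = 0 ∧
  p0 * q0 + c * p1 * q1 ≠ 0

def Iso3 (b c : F) : Prop := ∃ p0 p1 p2 q0 q1 q2 : F, p0 ^ 2 + b * p1 ^ 2 + c * p2 ^ 2 = 0 ∧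
  q0 ^ 2 + b * q1 ^ 2 + c * q2 ^ 2 = 0 ∧ p0 * q0 + b * p1 * q1 + c * p2 * q2 ≠ 0

theorem caseA (hd : Module.finrank F A = 4)
    (h3 : ∀ x y z : A, x * y * z = 0)
    (hK : ∃ v : A, ∀ x y : A, ∃ c : F, x * y = c • v)
    (hz : ∃ x y : A, x * y ≠ 0) (ε : F) (S : Prop)
    (he : ∀ c : F, c ≠ 0 → Iso2 c ∨ ∃ s : F, s ≠ 0 ∧ c = -ε * s ^ 2)
    (hr : ∀ b c : F, b ≠ 0 → c ≠ 0 → Iso3 b c ∨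
      (S ∧ ∃ s t : F, s ≠ 0 ∧ t ≠ 0 ∧ b = s ^ 2 ∧ c = t ^ 2)) :
    HasA A (1 : F) 0 0 0 ∨ HasA A (0 : F) 1 0 0 ∨ HasA A (1 : F) 0 (-ε) 0 ∨ HasA A (0 : F) 1 0 1 ∨
      (S ∧ HasA A (1 : F) 0 1 1) := by
  have hK' : ∀ v : A, v ≠ 0 → (∃ p q, v = p * q) → ∀ x y : A, ∃ c : F, x * y = c • v := by
    rintro v hv ⟨p, q, rfl⟩ x y
    obtain ⟨v0, h0⟩ := hK
    obtain ⟨c, hc⟩ := h0 p q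
    obtain ⟨d, hd⟩ := h0 x y
    have c0 : c ≠ 0 := by
      rintro rfl
      exact hv (by rw [hc, zero_smul])
    refine ⟨d * c⁻¹, ?_⟩
    rw [hc, hd, smul_smul, mul_assoc, inv_mul_cancel₀ c0, mul_one]
  by_cases hI : ∃ x y : A, x * x = 0 ∧ y * y = 0 ∧ x * y ≠ 0
  · obtain ⟨x, y, hx, hy, hxy⟩ := hI
    obtain ⟨v, hv⟩ : ∃ v, v = x * y := ⟨_, rfl⟩
    have hv0 : v ≠ 0 := hv ▸ hxy
    have hvt : ∀ t, v * t = 0 := fun t => by rw [hv, h3]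
    have htv : ∀ t, t * v = 0 := fun t => by rw [mul_comm, hvt]
    have hyx : y * x = v := by rw [mul_comm, hv]
    have KK := hK' v hv0 ⟨_, _, hv⟩
    obtain ⟨z, hl⟩ := ext3 (F := F) hd x y v (by
      intro a b c e
      have e1 := congrArg (fun t => t * y) e
      have e2 := congrArg (fun t => t * x) e
      simp only [add_mul, smul_mul_assoc, hx, hy, hyx, ← hv, hvt, smul_zero, zero_add, add_zero,
        zero_mul, smul_eq_zero, hv0, or_false] at e1 e2
      subst e1 e2
      simpa [hv0] using e)
    obtain ⟨m, hm⟩ := KK x z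
    obtain ⟨n, hn⟩ := KK y z
    obtain ⟨w, hw⟩ : ∃ w, w = z - n • x - m • y := ⟨_, rfl⟩
    have hxw : x * w = 0 := by
      rw [hw]
      simp only [mul_sub, mul_smul_comm, hx, hm, ← hv]
      module
    have hyw : y * w = 0 := by
      rw [hw]
      simp only [mul_sub, mul_smul_comm, hy, hn, hyx]
      module
    have hl2 : LI4 F x y w v := by
      intro a b c d e
      rw [hw] at e
      obtain ⟨h1, h2, h3, h4⟩ := hl (a - c * n) (b - c * m) d c (by
        linear_combination (norm := module) e)
      subst h4
      simp only [zero_mul, sub_zero] at h1 h2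
      exact ⟨h1, h2, rfl, h3⟩
    obtain ⟨c, hc⟩ := KK w w
    by_cases hc0 : c = 0
    · right; left
      exact ⟨x, y, w, v, hl2, by simp [hx], by simp [hv], by simp [hy], by simp [hc, hc0],
        hxw, hyw, hvt⟩
    · right; right; right; left
      refine ⟨c • x, y, w, c • v, ?_, by simp [smul_mul_assoc, mul_smul_comm, hx],
        by simp [smul_mul_assoc, hv], by simp [hy], by simp [hc],
        by simp [smul_mul_assoc, hxw], hyw, fun t => by simp [smul_mul_assoc, hvt]⟩
      simpa using hl2.smul hc0 one_ne_zero one_ne_zero hc0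
  · have hI' : ∀ x y : A, x * x = 0 → y * y = 0 → x * y = 0 := by
      intro x y h1 h2
      by_contra h
      exact hI ⟨x, y, h1, h2, h⟩
    obtain ⟨x, hx⟩ : ∃ x : A, x * x ≠ 0 := by
      by_contra! hc
      obtain ⟨p, q, hpq⟩ := hz
      exact hpq (hI' p q (hc p) (hc q))
    obtain ⟨v, hv⟩ : ∃ v, v = x * x := ⟨_, rfl⟩
    have hv0 : v ≠ 0 := hv ▸ hx
    have hvt : ∀ t, v * t = 0 := fun t => by rw [hv, h3]
    have KK := hK' v hv0 ⟨_, _, hv⟩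
    have hxx : x * x = v := hv.symm
    clear hv hx
    obtain ⟨y0, z0, hl0⟩ := ext2 (F := F) hd x v (by
      intro a b e
      have e1 := congrArg (fun t => t * x) e
      simp only [add_mul, smul_mul_assoc, hxx, hvt, smul_zero, add_zero,
        zero_mul, smul_eq_zero, hv0, or_false] at e1
      subst e1
      simpa [hv0] using e)
    obtain ⟨m, hm⟩ := KK x y0
    obtain ⟨n, hn⟩ := KK x z0
    obtain ⟨y1, hy1⟩ : ∃ w, w = y0 - m • x := ⟨_, rfl⟩
    obtain ⟨z1, hz1⟩ : ∃ w, w = z0 - n • x := ⟨_, rfl⟩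
    have hxy1 : x * y1 = 0 := by
      rw [hy1]
      simp only [mul_sub, mul_smul_comm, hxx, hm]
      module
    have hxz1 : x * z1 = 0 := by
      rw [hz1]
      simp only [mul_sub, mul_smul_comm, hxx, hn]
      module
    have hl1 : LI4 F x y1 z1 v := by
      intro a b c d e
      rw [hy1, hz1] at e
      obtain ⟨h1, h2, h3, h4⟩ := hl0 (a - b * m - c * n) d b c (by
        linear_combination (norm := module) e)
      subst h3 h4
      simp only [zero_mul, sub_zero] at h1
      exact ⟨h1, rfl, rfl, h2⟩
    by_cases hall : y1 * y1 = 0 ∧ z1 * z1 = 0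
    · left
      exact ⟨x, y1, z1, v, hl1, by simp [hxx], by simp [hxy1], by simp [hall.1], by simp [hall.2],
        hxz1, hI' _ _ hall.1 hall.2, hvt⟩
    obtain ⟨y, z2, hl2, hxy, hxz2, hyy⟩ : ∃ y z : A, LI4 F x y z v ∧ x * y = 0 ∧ x * z = 0 ∧
        y * y ≠ 0 := by
      by_cases h : y1 * y1 = 0
      · refine ⟨z1, y1, ?_, hxz1, hxy1, fun h' => hall ⟨h, h'⟩⟩
        intro a b c d e
        obtain ⟨h1, h2, h3, h4⟩ := hl1 a c b d (by linear_combination (norm := module) e)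
        exact ⟨h1, h3, h2, h4⟩
      · exact ⟨y1, z1, hl1, hxy1, hxz1, h⟩
    obtain ⟨b, hb⟩ := KK y y
    have hb0 : b ≠ 0 := by
      rintro rfl
      exact hyy (by rw [hb, zero_smul])
    obtain ⟨e, he1⟩ := KK y z2
    obtain ⟨z, hz⟩ : ∃ w, w = z2 - (e * b⁻¹) • y := ⟨_, rfl⟩
    have hxz : x * z = 0 := by
      rw [hz]
      simp only [mul_sub, mul_smul_comm, hxy, hxz2]
      module
    have hyz : y * z = 0 := by
      rw [hz]
      simp only [mul_sub, mul_smul_comm, he1, hb, smul_smul, mul_assoc, inv_mul_cancel₀ hb0]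
      module
    have hl3 : LI4 F x y z v := by
      intro a1 b1 c1 d1 e1
      rw [hz] at e1
      obtain ⟨h1, h2, h3, h4⟩ := hl2 a1 (b1 - c1 * (e * b⁻¹)) c1 d1 (by
        linear_combination (norm := module) e1)
      subst h3
      simp only [zero_mul, sub_zero] at h2
      exact ⟨h1, h2, rfl, h4⟩
    obtain ⟨c, hc⟩ := KK z z
    have prod : ∀ p0 p1 p2 q0 q1 q2 : F, (p0 • x + p1 • y + p2 • z) * (q0 • x + q1 • y + q2 • z) =
        (p0 * q0 + b * p1 * q1 + c * p2 * q2) • v := by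
      intro p0 p1 p2 q0 q1 q2
      simp only [mul_add, add_mul, smul_mul_assoc, mul_smul_comm, hxx, hxy, hxz, hb, hyz, hc,
        mul_comm y x, mul_comm z x, mul_comm z y]
      module
    have noI : ¬ Iso3 b c := by
      rintro ⟨p0, p1, p2, q0, q1, q2, f1, f2, f3⟩
      have := hI' (p0 • x + p1 • y + p2 • z) (q0 • x + q1 • y + q2 • z)
        (by rw [prod, show p0 * p0 + b * p1 * p1 + c * p2 * p2 = 0 by rw [← f1]; ring, zero_smul])
        (by rw [prod, show q0 * q0 + b * q1 * q1 + c * q2 * q2 = 0 by rw [← f2]; ring, zero_smul])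
      rw [prod, smul_eq_zero] at this
      tauto
    by_cases hc0 : c = 0
    · rcases he b hb0 with ⟨p0, p1, q0, q1, f1, f2, f3⟩ | ⟨s, hs, hbs⟩
      · exfalso
        exact noI ⟨p0, p1, 0, q0, q1, 0, by simpa using f1, by simpa using f2, by simpa using f3⟩
      · right; right; left
        refine ⟨x, s⁻¹ • y, z, v, ?_, by simp [hxx], by simp [mul_smul_comm, hxy],
          ?_, by simp [hc, hc0], hxz, by simp [smul_mul_assoc, hyz], hvt⟩
        · simpa using hl3.smul one_ne_zero (inv_ne_zero hs) one_ne_zero one_ne_zero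
        · rw [smul_mul_assoc, mul_smul_comm, hb, hbs, smul_smul, smul_smul]
          congr 1
          field_simp
    · rcases hr b c hb0 hc0 with h | ⟨hS, s, t, hs, ht, hbs, hct⟩
      · exact absurd h noI
      · right; right; right; right
        refine ⟨hS, x, s⁻¹ • y, t⁻¹ • z, v, ?_, by simp [hxx], by simp [mul_smul_comm, hxy],
          ?_, ?_, by simp [mul_smul_comm, hxz], by simp [smul_mul_assoc, mul_smul_comm, hyz], hvt⟩
        · simpa using hl3.smul one_ne_zero (inv_ne_zero hs) (inv_ne_zero ht) one_ne_zero
        · rw [smul_mul_assoc, mul_smul_comm, hb, hbs, smul_smul, smul_smul]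
          congr 1
          field_simp
        · rw [smul_mul_assoc, mul_smul_comm, hc, hct, smul_smul, smul_smul]
          congr 1
          field_simp

theorem caseB (hd : Module.finrank F A = 4)
    (h3 : ∀ x y z : A, x * y * z = 0)
    (hK : ¬ ∃ v : A, ∀ x y : A, ∃ c : F, x * y = c • v) (α β : F)
    (hq : ∀ s t : F, (∀ r : F, r ^ 2 ≠ s * r + t) →
      ∃ q k : F, k ≠ 0 ∧ s + 2 * q = α * k ∧ t + q ^ 2 = α * k * q + β * k ^ 2) :
    HasB A (0 : F) 0 1 ∨ HasB A (1 : F) 0 0 ∨ HasB A α β 1 := by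
  push Not at hK
  have h3' : ∀ x y z : A, x * (y * z) = 0 := fun x y z => by rw [← mul_assoc, h3]
  obtain ⟨p1, p2, hp⟩ := hK 0
  obtain ⟨q1, q2, hqq⟩ := hK (p1 * p2)
  -- any x, y independent modulo the annihilator give a basis
  have basis : ∀ x y : A, (∀ a b : F, (∀ t, (a • x + b • y) * t = 0) → a = 0 ∧ b = 0) →
      LI4 F x y (p1 * p2) (q1 * q2) := by
    intro x y hxy a b c d e
    obtain ⟨rfl, rfl⟩ := hxy a b (by
      intro t
      have := congrArg (fun s => s * t) e
      simpa only [add_mul, smul_mul_assoc, h3, smul_zero, add_zero, zero_mul] using this)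
    have hd0 : d = 0 := by
      by_contra hd0
      apply hqq (-(d⁻¹ * c))
      have : q1 * q2 = d⁻¹ • (d • (q1 * q2)) := by rw [smul_smul, inv_mul_cancel₀ hd0, one_smul]
      rw [this, eq_neg_of_add_eq_zero_right e]
      module
    subst hd0
    have : c • (p1 * p2) = 0 := by simpa using e
    rw [smul_eq_zero] at this
    rcases this with h | h
    · exact ⟨rfl, rfl, h, rfl⟩
    · exact absurd (by simpa using h) (hp 0)
  have prods : ∀ x y : A, (∀ a b : F, (∀ t, (a • x + b • y) * t = 0) → a = 0 ∧ b = 0) →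
      ∀ p q : A, ∃ a b c : F, p * q = a • (x * x) + b • (x * y) + c • (y * y) := by
    intro x y hxy p q
    obtain ⟨a, b, c, d, rfl⟩ := (basis x y hxy).span hd p
    obtain ⟨a', b', c', d', rfl⟩ := (basis x y hxy).span hd q
    refine ⟨a * a', a * b' + b * a', b * b', ?_⟩
    simp only [mul_add, add_mul, smul_mul_assoc, mul_smul_comm, h3, h3', mul_comm y x]
    module
  have fin : ∀ x y u w : A, (∀ a b : F, (∀ t, (a • x + b • y) * t = 0) → a = 0 ∧ b = 0) →
      (∀ t, u * t = 0) → (∀ t, w * t = 0) → (∀ c d : F, c • u + d • w = 0 → c = 0 ∧ d = 0) →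
      LI4 F x y u w := by
    intro x y u w hxy hu hw huw a b c d e
    obtain ⟨rfl, rfl⟩ := hxy a b (by
      intro t
      have := congrArg (fun s => s * t) e
      simpa only [add_mul, smul_mul_assoc, hu, hw, smul_zero, add_zero, zero_mul] using this)
    obtain ⟨h1, h2⟩ := huw c d (by simpa using e)
    exact ⟨rfl, rfl, h1, h2⟩
  have indep : ∀ u w : A, u ≠ 0 → (∀ c : F, w ≠ c • u) →
      ∀ c d : F, c • u + d • w = 0 → c = 0 ∧ d = 0 := by
    intro u w hu hw c d e
    have hd0 : d = 0 := by
      by_contra hd0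
      apply hw (-(d⁻¹ * c))
      have : w = d⁻¹ • (d • w) := by rw [smul_smul, inv_mul_cancel₀ hd0, one_smul]
      rw [this, eq_neg_of_add_eq_zero_right e]
      module
    subst hd0
    have : c • u = 0 := by simpa using e
    rw [smul_eq_zero] at this
    exact ⟨this.resolve_right hu, rfl⟩
  by_cases hJ : ∃ x y : A, x * x = 0 ∧ x * y ≠ 0
  · left
    obtain ⟨x, y, hx, hxy⟩ := hJ
    have hi : ∀ a b : F, (∀ t, (a • x + b • y) * t = 0) → a = 0 ∧ b = 0 := by
      intro a b h
      have e1 := h x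
      have e2 := h y
      simp only [add_mul, smul_mul_assoc, hx, mul_comm y x, smul_zero, zero_add, smul_eq_zero, hxy,
        or_false] at e1 e2
      subst e1
      simpa [hxy] using e2
    refine ⟨x, y, x * y, y * y, ?_, by simp [hx], by simp, rfl, h3 _ _, h3 _ _⟩
    refine fin _ _ _ _ hi (h3 _ _) (h3 _ _) (indep _ _ hxy ?_)
    intro c hc
    obtain ⟨p, q, hpq⟩ := hK (x * y)
    obtain ⟨a', b', c', e⟩ := prods x y hi p q
    apply hpq (b' + c' * c)
    rw [e, hx, hc]
    module
  have hJ' : ∀ x y : A, x * x = 0 → x * y = 0 := by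
    intro x y h
    by_contra h'
    exact hJ ⟨x, y, h, h'⟩
  by_cases hJJ : ∃ x y : A, x * y = 0 ∧ x * x ≠ 0 ∧ y * y ≠ 0
  · right; left
    obtain ⟨x, y, hxy, hx, hy⟩ := hJJ
    have hi : ∀ a b : F, (∀ t, (a • x + b • y) * t = 0) → a = 0 ∧ b = 0 := by
      intro a b h
      have e1 := h x
      have e2 := h y
      simp only [add_mul, smul_mul_assoc, hxy, mul_comm y x, smul_zero, zero_add, add_zero,
        smul_eq_zero, hx, hy, or_false] at e1 e2
      exact ⟨e1, e2⟩
    refine ⟨x, y, x * x, y * y, ?_, by simp, by simp [hxy], rfl, h3 _ _, h3 _ _⟩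
    refine fin _ _ _ _ hi (h3 _ _) (h3 _ _) (indep _ _ hx ?_)
    intro c hc
    obtain ⟨p, q, hpq⟩ := hK (x * x)
    obtain ⟨a', b', c', e⟩ := prods x y hi p q
    apply hpq (a' + c' * c)
    rw [e, hxy, hc]
    module
  right; right
  -- zero products only involve the annihilator
  have hJJ' : ∀ x y : A, x * y = 0 → (∀ t, x * t = 0) ∨ (∀ t, y * t = 0) := by
    intro x y h
    by_contra! hc
    obtain ⟨⟨t, ht⟩, ⟨s, hs⟩⟩ := hc
    exact hJJ ⟨x, y, h, fun h' => ht (hJ' _ _ h'), fun h' => hs (hJ' _ _ h')⟩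
  obtain ⟨x, y, hi⟩ : ∃ x y : A, ∀ a b : F, (∀ t, (a • x + b • y) * t = 0) → a = 0 ∧ b = 0 := by
    by_contra! hc
    have hp0 : p1 * p2 ≠ 0 := by simpa using hp 0
    obtain ⟨y, hy⟩ : ∃ y, y = p1 := ⟨_, rfl⟩
    have key : ∀ x : A, ∃ c : F, ∀ t, x * t = c • (y * t) := by
      intro x
      obtain ⟨a, b, h1, h2⟩ := hc x y
      have ha : a ≠ 0 := by
        intro ha
        have hb := h2 ha
        have := h1 p2
        rw [ha, hy, zero_smul, zero_add, smul_mul_assoc, smul_eq_zero] at this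
        tauto
      refine ⟨-(a⁻¹ * b), fun t => ?_⟩
      have := h1 t
      rw [add_mul, smul_mul_assoc, smul_mul_assoc] at this
      have h5 : x * t = a⁻¹ • (a • (x * t)) := by rw [smul_smul, inv_mul_cancel₀ ha, one_smul]
      rw [h5, eq_neg_of_add_eq_zero_left this]
      module
    obtain ⟨p, q, hpq⟩ := hK (y * y)
    obtain ⟨c, hcc⟩ := key p
    obtain ⟨d, hdd⟩ := key q
    apply hpq (c * d)
    rw [hcc, mul_comm y q, hdd, smul_smul]
  have annsp : ∀ a b : A, ∃ c d : F, a * b = c • (p1 * p2) + d • (q1 * q2) := by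
    intro a b
    obtain ⟨k, l, c, d, e⟩ := (basis x y hi).span hd (a * b)
    obtain ⟨rfl, rfl⟩ := hi k l (by
      intro t
      have := congrArg (fun s => s * t) e
      simp only [add_mul, smul_mul_assoc, h3, smul_zero, add_zero] at this
      rw [add_mul, smul_mul_assoc, smul_mul_assoc, ← this])
    exact ⟨c, d, by rw [e]; module⟩
  have nz : ∀ a b : F, y * (a • x + b • y) = 0 → a = 0 ∧ b = 0 := by
    intro a b h
    rcases hJJ' _ _ h with h | h
    · have := (hi 0 1 (by intro t; rw [zero_smul, one_smul, zero_add, h])).2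
      exact absurd this one_ne_zero
    · exact hi a b h
  obtain ⟨s, t, hst⟩ : ∃ s t : F, x * x = s • (x * y) + t • (y * y) := by
    obtain ⟨a1, b1, e1⟩ := annsp x y
    obtain ⟨a2, b2, e2⟩ := annsp y y
    obtain ⟨a3, b3, e3⟩ := annsp x x
    have hD : a1 * b2 - a2 * b1 ≠ 0 := by
      intro hD
      obtain ⟨g1, g2⟩ := nz b2 (-b1) (by
        simp only [mul_add, mul_smul_comm, mul_comm y x]
        rw [e1, e2]
        linear_combination (norm := module) hD • (p1 * p2))
      obtain ⟨g3, g4⟩ := nz a2 (-a1) (by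
        simp only [mul_add, mul_smul_comm, mul_comm y x]
        rw [e1, e2]
        linear_combination (norm := module) -hD • (q1 * q2))
      have : y * y = 0 := by rw [e2, g1, g3]; simp
      have := nz 0 1 (by simp [this])
      exact one_ne_zero this.2
    obtain ⟨D, hDd⟩ : ∃ D, D = a1 * b2 - a2 * b1 := ⟨_, rfl⟩
    rw [← hDd] at hD
    refine ⟨(a3 * b2 - a2 * b3) / D, (a1 * b3 - a3 * b1) / D, ?_⟩
    rw [e1, e2, e3]
    match_scalars <;> field_simp <;> rw [hDd] <;> ring
  have noroot : ∀ r : F, r ^ 2 ≠ s * r + t := by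
    intro r hr
    have e : (x + (-r) • y) * (x + (-(s - r)) • y) = 0 := by
      simp only [mul_add, add_mul, smul_mul_assoc, mul_smul_comm, mul_comm y x]
      rw [hst]
      linear_combination (norm := module) -hr • (y * y)
    rcases hJJ' _ _ e with h | h
    · exact one_ne_zero (hi 1 (-r) (by simpa only [one_smul] using h)).1
    · exact one_ne_zero (hi 1 (-(s - r)) (by simpa only [one_smul] using h)).1
  obtain ⟨q, k, hk, g1, g2⟩ := hq s t noroot
  refine ⟨x + q • y, k • y, (x + q • y) * (k • y), (k • y) * (k • y), ?_, ?_, by simp, rfl,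
    h3 _ _, h3 _ _⟩
  · refine fin _ _ _ _ ?_ (h3 _ _) (h3 _ _) ?_
    · intro a b h
      obtain ⟨j1, j2⟩ := hi a (a * q + b * k) (by
        intro t
        rw [← h t]
        congr 1
        module)
      subst j1
      simpa [hk] using j2
    · intro c d e
      obtain ⟨j1, j2⟩ := nz (c * k) (c * k * q + d * k ^ 2) (by
        rw [← e]
        simp only [mul_add, add_mul, smul_mul_assoc, mul_smul_comm, mul_comm y x]
        module)
      have hc : c = 0 := by simpa [hk] using j1
      subst hc
      simpa [hk] using j2
  · simp only [mul_add, add_mul, smul_mul_assoc, mul_smul_comm, mul_comm y x]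
    rw [hst]
    linear_combination (norm := module) g1 • (x * y) + g2 • (y * y)

end Class


section FieldFacts

structure FieldHyp {F : Type*} [Field F] (ε α β : F) (S : Prop) : Prop where
  e0 : ε ≠ 0
  e1 : ¬ Iso2 (-ε)
  he : ∀ c : F, c ≠ 0 → Iso2 c ∨ ∃ s : F, s ≠ 0 ∧ c = -ε * s ^ 2
  hr : ∀ b c : F, b ≠ 0 → c ≠ 0 → Iso3 b c ∨
      (S ∧ ∃ s t : F, s ≠ 0 ∧ t ≠ 0 ∧ b = s ^ 2 ∧ c = t ^ 2)
  hS : S → ¬ Iso3 (1 : F) 1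
  q1 : ∀ r : F, r ^ 2 ≠ α * r + β
  hq : ∀ s t : F, (∀ r : F, r ^ 2 ≠ s * r + t) →
      ∃ q k : F, k ≠ 0 ∧ s + 2 * q = α * k ∧ t + q ^ 2 = α * k * q + β * k ^ 2

theorem fieldHyp_real : FieldHyp (-1 : ℝ) 0 (-1) True where
  e0 := by norm_num
  e1 := by
    rintro ⟨p0, p1, q0, q1, f1, f2, f3⟩
    apply f3
    have h0 : p0 = 0 := by nlinarith [sq_nonneg p0, sq_nonneg p1]
    have h1 : p1 = 0 := by nlinarith [sq_nonneg p0, sq_nonneg p1]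
    simp [h0, h1]
  he c hc := by
    rcases lt_or_gt_of_ne hc with h | h
    · left
      have hs := Real.sq_sqrt (show 0 ≤ -c by linarith)
      refine ⟨√(-c), 1, √(-c), -1, ?_, ?_, ?_⟩
      · linarith
      · linarith
      · intro h'; nlinarith
    · right
      have hs := Real.sq_sqrt h.le
      exact ⟨√c, by positivity, by linarith⟩
  hr b c hb hc := by
    rcases lt_or_gt_of_ne hb with h | h
    · left
      have hs := Real.sq_sqrt (show 0 ≤ -b by linarith)
      refine ⟨√(-b), 1, 0, √(-b), -1, 0, ?_, ?_, ?_⟩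
      · linarith
      · linarith
      · intro h'; nlinarith
    rcases lt_or_gt_of_ne hc with h1 | h1
    · left
      have hs := Real.sq_sqrt (show 0 ≤ -c by linarith)
      refine ⟨√(-c), 0, 1, √(-c), 0, -1, ?_, ?_, ?_⟩
      · linarith
      · linarith
      · intro h'; nlinarith
    right
    exact ⟨trivial, √b, √c, by positivity, by positivity, (Real.sq_sqrt h.le).symm,
      (Real.sq_sqrt h1.le).symm⟩
  hS := by
    rintro - ⟨p0, p1, p2, q0, q1, q2, f1, f2, f3⟩
    apply f3
    have h0 : p0 = 0 := by nlinarith [sq_nonneg p0, sq_nonneg p1, sq_nonneg p2]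
    have h1 : p1 = 0 := by nlinarith [sq_nonneg p0, sq_nonneg p1, sq_nonneg p2]
    have h2 : p2 = 0 := by nlinarith [sq_nonneg p0, sq_nonneg p1, sq_nonneg p2]
    simp [h0, h1, h2]
  q1 r := by intro h; nlinarith [sq_nonneg r]
  hq s t h := by
    have hD : t + s ^ 2 / 4 < 0 := by
      by_contra! hc
      have hs := Real.sq_sqrt hc
      apply h (s / 2 + √(t + s ^ 2 / 4))
      nlinarith
    have hs := Real.sq_sqrt (show 0 ≤ -(t + s ^ 2 / 4) by linarith)
    have hp : 0 < √(-(t + s ^ 2 / 4)) := Real.sqrt_pos.2 (by linarith)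
    exact ⟨-s / 2, √(-(t + s ^ 2 / 4)), hp.ne', by ring, by nlinarith⟩

theorem fieldHyp_odd (F : Type*) [Field F] [Fintype F] (h2 : ringChar F ≠ 2) :
    ∃ ε : F, FieldHyp ε 0 ε False := by
  classical
  obtain ⟨ε, hε⟩ := FiniteField.exists_nonsquare h2
  have h2' : (2 : F) ≠ 0 := Ring.two_ne_zero h2
  have e0 : ε ≠ 0 := by rintro rfl; exact hε IsSquare.zero
  have ratio : ∀ a : F, ¬ IsSquare a → ∃ s, s ≠ 0 ∧ a = ε * s ^ 2 := by
    intro a ha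
    have a0 : a ≠ 0 := by rintro rfl; exact ha IsSquare.zero
    have h1 := (FiniteField.pow_dichotomy h2 a0).resolve_left
      (fun h => ha ((FiniteField.isSquare_iff h2 a0).2 h))
    have h3 := (FiniteField.pow_dichotomy h2 e0).resolve_left
      (fun h => hε ((FiniteField.isSquare_iff h2 e0).2 h))
    obtain ⟨r, hr⟩ := (FiniteField.isSquare_iff h2 (mul_ne_zero a0 e0)).2
      (by rw [mul_pow, h1, h3]; ring)
    refine ⟨r / ε, ?_, ?_⟩
    · apply div_ne_zero _ e0
      rintro rfl
      simp [a0, e0] at hr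
    · field_simp
      linear_combination hr
  refine ⟨ε, e0, ?_, ?_, ?_, fun h => h.elim, ?_, ?_⟩
  · rintro ⟨p0, p1, q0, q1, f1, f2, f3⟩
    have h1 : p1 = 0 := by
      by_contra h1
      apply hε
      refine ⟨p0 / p1, ?_⟩
      field_simp
      linear_combination -f1
    subst h1
    have h0 : p0 = 0 := by simpa using f1
    apply f3
    simp [h0]
  · intro c hc
    by_cases hs : IsSquare (-c)
    · left
      obtain ⟨d, hd⟩ := hs
      refine ⟨d, 1, d, -1, by linear_combination -hd, by linear_combination -hd, ?_⟩
      intro h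
      have : 2 * c = 0 := by linear_combination -h - hd
      simp [h2', hc] at this
    · right
      obtain ⟨s, hs, h⟩ := ratio _ hs
      exact ⟨s, hs, by linear_combination -h⟩
  · intro b c hb hc
    left
    obtain ⟨x, y, hxy⟩ := FiniteField.exists_root_sum_quadratic
      (f := Polynomial.C b * Polynomial.X ^ 2 + Polynomial.C 0 * Polynomial.X + Polynomial.C 1)
      (g := Polynomial.C c * Polynomial.X ^ 2 + Polynomial.C 0 * Polynomial.X + Polynomial.C 0)
      (Polynomial.degree_quadratic hb) (Polynomial.degree_quadratic hc)
      (FiniteField.odd_card_of_char_ne_two h2)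
    simp at hxy
    refine ⟨1, x, y, 1 - 1 / 2, - x / 2, - y / 2, by linear_combination hxy, ?_, ?_⟩
    · field_simp
      linear_combination hxy
    · have : (1 : F) * (1 - 1 / 2) + b * x * (-x / 2) + c * y * (-y / 2) = 1 := by
        field_simp
        linear_combination -hxy
      rw [this]
      exact one_ne_zero
  · intro r h
    exact hε ⟨r, by linear_combination -h⟩
  · intro s t h
    obtain ⟨k, hk, e⟩ := ratio (t + (s / 2) ^ 2) (by
      rintro ⟨r, hr⟩
      apply h (s / 2 + r)
      field_simp at hr ⊢
      linear_combination -hr)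
    exact ⟨-s / 2, k, hk, by field_simp; ring, by linear_combination e⟩

theorem fieldHyp_even (F : Type*) [Field F] [Fintype F] (h2 : ringChar F = 2) :
    ∃ β : F, FieldHyp (1 : F) 1 β False := by
  classical
  haveI : CharP F 2 := h2 ▸ ringChar.charP F
  have two : (2 : F) = 0 := CharTwo.two_eq_zero
  have sqr : ∀ a : F, ∃ s, a = s ^ 2 := by
    intro a
    obtain ⟨s, hs⟩ := FiniteField.isSquare_of_char_two h2 a
    exact ⟨s, by rw [hs, sq]⟩
  let φ : F →+ F :=
    { toFun := fun u => u ^ 2 + u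
      map_zero' := by simp
      map_add' := fun x y => by linear_combination (x * y) * two }
  have hφ : ∀ u, φ u = u ^ 2 + u := fun u => rfl
  have hker : Nat.card φ.ker = 2 := by
    have : (φ.ker : Set F) = {0, 1} := by
      ext u
      simp only [SetLike.mem_coe, AddMonoidHom.mem_ker, hφ, Set.mem_insert_iff,
        Set.mem_singleton_iff]
      constructor
      · intro h
        have : u * (u - 1) = 0 := by linear_combination h - u * two
        rcases mul_eq_zero.1 this with h | h
        · exact Or.inl h
        · exact Or.inr (sub_eq_zero.1 h)
      · rintro (rfl | rfl)
        · simp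
        · linear_combination two
    change Nat.card (φ.ker : Set F) = 2
    rw [this, Nat.card_coe_set_eq, Set.ncard_pair zero_ne_one]
  have hidx : φ.range.index = 2 := by
    have h1 := AddSubgroup.card_mul_index φ.range
    have h3 := AddSubgroup.card_mul_index φ.ker
    rw [AddSubgroup.index_ker, hker] at h3
    have h4 : 0 < Nat.card φ.range := Nat.card_pos
    have : Nat.card φ.range * φ.range.index = Nat.card φ.range * 2 := by
      rw [h1, ← h3, mul_comm]
    exact Nat.eq_of_mul_eq_mul_left h4 this
  obtain ⟨β, hβ⟩ : ∃ β, β ∉ φ.range := by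
    by_contra! hc
    have : φ.range = ⊤ := (AddSubgroup.eq_top_iff' _).2 hc
    rw [this, AddSubgroup.index_top] at hidx
    omega
  refine ⟨β, one_ne_zero, ?_, ?_, ?_, fun h => h.elim, ?_, ?_⟩
  · rintro ⟨p0, p1, q0, q1, f1, f2, f3⟩
    have g1 : p0 = p1 := by
      have : (p0 - p1) ^ 2 = 0 := by linear_combination f1 + (p1 ^ 2 - p0 * p1) * two
      exact sub_eq_zero.1 (by simpa using this)
    have g2 : q0 = q1 := by
      have : (q0 - q1) ^ 2 = 0 := by linear_combination f2 + (q1 ^ 2 - q0 * q1) * two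
      exact sub_eq_zero.1 (by simpa using this)
    apply f3
    rw [g1, g2]; ring
  · intro c hc
    right
    obtain ⟨s, hs⟩ := sqr c
    refine ⟨s, ?_, ?_⟩
    · rintro rfl
      simp at hs; exact hc hs
    · linear_combination hs + s ^ 2 * two
  · intro b c hb hc
    left
    obtain ⟨s, rfl⟩ := sqr b
    obtain ⟨t, rfl⟩ := sqr c
    refine ⟨s, 1, 0, t, 0, 1, by linear_combination s ^ 2 * two,
      by linear_combination t ^ 2 * two, ?_⟩
    have : s ≠ 0 := by rintro rfl; simp at hb
    have : t ≠ 0 := by rintro rfl; simp at hc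
    simp [*]
  · intro r h
    exact hβ ⟨r, by rw [hφ]; linear_combination h + r * two⟩
  · intro s t h
    have hs : s ≠ 0 := by
      rintro rfl
      obtain ⟨r, hr⟩ := sqr t
      exact h r (by rw [hr]; ring)
    have ht : t / s ^ 2 ∉ φ.range := by
      rintro ⟨u, hu⟩
      rw [hφ] at hu
      field_simp at hu
      apply h (s * u)
      linear_combination hu - s ^ 2 * u * two
    have hm : β + t / s ^ 2 ∈ φ.range := by
      rw [AddSubgroup.add_mem_iff_of_index_two hidx]
      simp [hβ, ht]
    obtain ⟨u, hu⟩ := hm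
    rw [hφ] at hu
    refine ⟨s * u, s, hs, by linear_combination s * u * two, ?_⟩
    field_simp at hu
    linear_combination hu - (s ^ 2 * u - t) * two

end FieldFacts


section Inv
variable {F : Type*} [Field F] (P : CommNilpAlgStr F 4)

def pZ : Prop := ∀ x y, P.mul x y = 0
def pT3 : Prop := ∀ x y z, P.mul (P.mul x y) z = 0
def pT4 : Prop := ∀ x y z w, P.mul (P.mul (P.mul x y) z) w = 0
def pK : Prop := ∃ v, ∀ x y, ∃ c : F, P.mul x y = c • v
def pL : Prop := ∃ v, ∀ x, (∀ t, P.mul x t = 0) → ∃ c : F, x = c • v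
def pM : Prop := ∃ x, ∀ y, ∃ c : F, ∀ t, P.mul y t = c • P.mul x t
def pI : Prop := ∃ x y, P.mul x x = 0 ∧ P.mul y y = 0 ∧ P.mul x y ≠ 0
def pJ : Prop := ∃ x t, P.mul x x = 0 ∧ P.mul x t ≠ 0
def pJJ : Prop := ∃ x y t s, P.mul x y = 0 ∧ P.mul x t ≠ 0 ∧ P.mul y s ≠ 0

open Classical in
noncomputable def code : ℕ :=
  if pZ P then 0 else if ¬ pT4 P then 10 else if ¬ pT3 P then (if pL P then 9 else 8)
  else if ¬ pK P then (if ¬ pJJ P then 7 else if pJ P then 5 else 6)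
  else if pM P then 1 else if ¬ pL P then (if pI P then 2 else 3)
  else if pI P then 4 else 11

variable {P} {Q : CommNilpAlgStr F 4}

theorem iso_symm (h : P.Iso Q) : Q.Iso P := by
  obtain ⟨e, he⟩ := h
  refine ⟨e.symm, fun x y => ?_⟩
  apply e.injective
  rw [he]
  simp

theorem pZ_mp (h : P.Iso Q) : pZ P → pZ Q := by
  obtain ⟨e, he⟩ := h
  intro H x y
  obtain ⟨x, rfl⟩ := e.surjective x
  obtain ⟨y, rfl⟩ := e.surjective y
  rw [← he, H, map_zero]

theorem pT3_mp (h : P.Iso Q) : pT3 P → pT3 Q := by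
  obtain ⟨e, he⟩ := h
  intro H x y z
  obtain ⟨x, rfl⟩ := e.surjective x
  obtain ⟨y, rfl⟩ := e.surjective y
  obtain ⟨z, rfl⟩ := e.surjective z
  rw [← he, ← he, H, map_zero]

theorem pT4_mp (h : P.Iso Q) : pT4 P → pT4 Q := by
  obtain ⟨e, he⟩ := h
  intro H x y z w
  obtain ⟨x, rfl⟩ := e.surjective x
  obtain ⟨y, rfl⟩ := e.surjective y
  obtain ⟨z, rfl⟩ := e.surjective z
  obtain ⟨w, rfl⟩ := e.surjective w
  rw [← he, ← he, ← he, H, map_zero]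

theorem pK_mp (h : P.Iso Q) : pK P → pK Q := by
  obtain ⟨e, he⟩ := h
  rintro ⟨v, H⟩
  refine ⟨e v, fun x y => ?_⟩
  obtain ⟨x, rfl⟩ := e.surjective x
  obtain ⟨y, rfl⟩ := e.surjective y
  obtain ⟨c, hc⟩ := H x y
  exact ⟨c, by rw [← he, hc, map_smul]⟩

theorem pL_mp (h : P.Iso Q) : pL P → pL Q := by
  obtain ⟨e, he⟩ := h
  rintro ⟨v, H⟩
  refine ⟨e v, fun x hx => ?_⟩
  obtain ⟨x, rfl⟩ := e.surjective x
  obtain ⟨c, hc⟩ := H x (fun t => e.injective (by rw [he, hx, map_zero]))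
  exact ⟨c, by rw [hc, map_smul]⟩

theorem pM_mp (h : P.Iso Q) : pM P → pM Q := by
  obtain ⟨e, he⟩ := h
  rintro ⟨v, H⟩
  refine ⟨e v, fun y => ?_⟩
  obtain ⟨y, rfl⟩ := e.surjective y
  obtain ⟨c, hc⟩ := H y
  refine ⟨c, fun t => ?_⟩
  obtain ⟨t, rfl⟩ := e.surjective t
  rw [← he, hc, map_smul, he]

theorem pI_mp (h : P.Iso Q) : pI P → pI Q := by
  obtain ⟨e, he⟩ := h
  rintro ⟨x, y, h1, h2, h3⟩
  refine ⟨e x, e y, by rw [← he, h1, map_zero], by rw [← he, h2, map_zero], ?_⟩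
  rw [← he]
  simpa using h3

theorem pJ_mp (h : P.Iso Q) : pJ P → pJ Q := by
  obtain ⟨e, he⟩ := h
  rintro ⟨x, y, h1, h3⟩
  refine ⟨e x, e y, by rw [← he, h1, map_zero], ?_⟩
  rw [← he]
  simpa using h3

theorem pJJ_mp (h : P.Iso Q) : pJJ P → pJJ Q := by
  obtain ⟨e, he⟩ := h
  rintro ⟨x, y, t, s, h1, h2, h3⟩
  refine ⟨e x, e y, e t, e s, by rw [← he, h1, map_zero], ?_, ?_⟩
  · rw [← he]
    simpa using h2
  · rw [← he]
    simpa using h3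

theorem code_congr (h : P.Iso Q) : code P = code Q := by
  have h' := iso_symm h
  have e1 : pZ P = pZ Q := propext ⟨pZ_mp h, pZ_mp h'⟩
  have e2 : pT3 P = pT3 Q := propext ⟨pT3_mp h, pT3_mp h'⟩
  have e3 : pT4 P = pT4 Q := propext ⟨pT4_mp h, pT4_mp h'⟩
  have e4 : pK P = pK Q := propext ⟨pK_mp h, pK_mp h'⟩
  have e5 : pL P = pL Q := propext ⟨pL_mp h, pL_mp h'⟩
  have e6 : pM P = pM Q := propext ⟨pM_mp h, pM_mp h'⟩
  have e7 : pI P = pI Q := propext ⟨pI_mp h, pI_mp h'⟩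
  have e8 : pJ P = pJ Q := propext ⟨pJ_mp h, pJ_mp h'⟩
  have e9 : pJJ P = pJJ Q := propext ⟨pJJ_mp h, pJJ_mp h'⟩
  unfold code
  rw [e1, e2, e3, e4, e5, e6, e7, e8, e9]

theorem famA_zero (a b c d : F) (x y : Fin 4 → F) : (famA a b c d).mul x y = 0 ↔
    a * x 0 * y 0 + b * (x 0 * y 1 + x 1 * y 0) + c * x 1 * y 1 + d * x 2 * y 2 = 0 := by
  rw [famA_mul]; simp

theorem famB_zero (a b c : F) (x y : Fin 4 → F) : (famB a b c).mul x y = 0 ↔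
    a * x 0 * y 0 + c * (x 0 * y 1 + x 1 * y 0) = 0 ∧ b * x 0 * y 0 + x 1 * y 1 = 0 := by
  rw [famB_mul]; simp

theorem famC_zero (d : F) (x y : Fin 4 → F) : (famC d).mul x y = 0 ↔
    x 0 * y 0 = 0 ∧ x 0 * y 2 + x 2 * y 0 + d * x 1 * y 1 = 0 := by
  rw [famC_mul]; simp

theorem famA_T3 (a b c d : F) : pT3 (famA a b c d) := by
  intro x y z
  simp [famA_mul]

theorem famA_T4 (a b c d : F) : pT4 (famA a b c d) := by
  intro x y z w
  simp [famA_mul]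

theorem famA_K (a b c d : F) : pK (famA a b c d) := by
  refine ⟨![0, 0, 0, 1], fun x y =>
    ⟨a * x 0 * y 0 + b * (x 0 * y 1 + x 1 * y 0) + c * x 1 * y 1 + d * x 2 * y 2, ?_⟩⟩
  rw [famA_mul]
  simp

theorem famA_nZ (a b c d : F) (h : a ≠ 0 ∨ b ≠ 0) : ¬ pZ (famA a b c d) := by
  intro H
  have h1 := H ![1, 0, 0, 0] ![1, 0, 0, 0]
  have h2 := H ![1, 0, 0, 0] ![0, 1, 0, 0]
  rw [famA_zero] at h1 h2
  simp at h1 h2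
  tauto

theorem famA_M : pM (famA (1 : F) 0 0 0) := by
  refine ⟨![1, 0, 0, 0], fun y => ⟨y 0, fun t => ?_⟩⟩
  rw [famA_mul, famA_mul]
  simp

theorem famA_nM (a b c d : F) (h : a * c - b ^ 2 ≠ 0) : ¬ pM (famA a b c d) := by
  rintro ⟨x, H⟩
  obtain ⟨k, hk⟩ := H ![1, 0, 0, 0]
  obtain ⟨l, hl⟩ := H ![0, 1, 0, 0]
  have h1 := congrFun (hk ![1, 0, 0, 0]) 3
  have h2 := congrFun (hk ![0, 1, 0, 0]) 3
  have h3 := congrFun (hl ![1, 0, 0, 0]) 3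
  have h4 := congrFun (hl ![0, 1, 0, 0]) 3
  simp [famA_mul] at h1 h2 h3 h4
  apply h
  linear_combination c * h1 + k * (a * x 0 + b * x 1) * h4 - b * h2 - k * (b * x 0 + c * x 1) * h3

theorem famA_L (a b c d : F) (h : a * c - b ^ 2 ≠ 0) (hd : d ≠ 0) : pL (famA a b c d) := by
  refine ⟨![0, 0, 0, 1], fun x hx => ⟨x 3, ?_⟩⟩
  have h1 := hx ![1, 0, 0, 0]
  have h2 := hx ![0, 1, 0, 0]
  have h3 := hx ![0, 0, 1, 0]
  simp [famA_zero] at h1 h2 h3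
  have g0 : x 0 = 0 := by
    have : (a * c - b ^ 2) * x 0 = 0 := by linear_combination c * h1 - b * h2
    simpa [h] using this
  have g1 : x 1 = 0 := by
    have : (a * c - b ^ 2) * x 1 = 0 := by linear_combination a * h2 - b * h1
    simpa [h] using this
  have g2 : x 2 = 0 := by simpa [hd] using h3
  ext i
  fin_cases i <;> simp [g0, g1, g2]

theorem famA_nL (a b c : F) : ¬ pL (famA a b c 0) := by
  rintro ⟨v, H⟩
  obtain ⟨k, hk⟩ := H ![0, 0, 1, 0] (by intro t; simp [famA_zero])
  obtain ⟨l, hl⟩ := H ![0, 0, 0, 1] (by intro t; simp [famA_zero])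
  have h1 := congrFun hk 2
  have h2 := congrFun hk 3
  have h3 := congrFun hl 2
  have h4 := congrFun hl 3
  simp at h1 h2 h3 h4
  grind

theorem famA_I (d : F) : pI (famA 0 1 0 d) := by
  refine ⟨![1, 0, 0, 0], ![0, 1, 0, 0], ?_, ?_, ?_⟩ <;> simp [famA_zero]

theorem famA_nI2 (c : F) (h : ¬ Iso2 c) : ¬ pI (famA 1 0 c 0) := by
  rintro ⟨x, y, h1, h2, h3⟩
  simp only [ne_eq, famA_zero] at h1 h2 h3
  refine h ⟨x 0, x 1, y 0, y 1, by linear_combination h1, by linear_combination h2, ?_⟩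
  intro h4
  apply h3
  linear_combination h4

theorem famA_nI3 (h : ¬ Iso3 (1 : F) 1) : ¬ pI (famA (1 : F) 0 1 1) := by
  rintro ⟨x, y, h1, h2, h3⟩
  simp only [ne_eq, famA_zero] at h1 h2 h3
  refine h ⟨x 0, x 1, x 2, y 0, y 1, y 2, by linear_combination h1, by linear_combination h2, ?_⟩
  intro h4
  apply h3
  linear_combination h4

theorem famB_nZ (a b c : F) : ¬ pZ (famB a b c) := by
  intro H
  have h1 := H ![0, 1, 0, 0] ![0, 1, 0, 0]
  simp [famB_zero] at h1

theorem famB_T3 (a b c : F) : pT3 (famB a b c) := by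
  intro x y z
  simp [famB_mul]

theorem famB_T4 (a b c : F) : pT4 (famB a b c) := by
  intro x y z w
  simp [famB_mul]

theorem famB_nK (a b c : F) (h : a ≠ 0 ∨ c ≠ 0) : ¬ pK (famB a b c) := by
  rintro ⟨v, H⟩
  obtain ⟨k, hk⟩ := H ![0, 1, 0, 0] ![0, 1, 0, 0]
  obtain ⟨l, hl⟩ := H ![1, 0, 0, 0] ![1, 0, 0, 0]
  obtain ⟨m, hm⟩ := H ![1, 0, 0, 0] ![0, 1, 0, 0]
  have h1 := congrFun hk 2
  have h2 := congrFun hk 3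
  have h3 := congrFun hl 2
  have h5 := congrFun hm 2
  simp [famB_mul] at h1 h2 h3 h5
  have hv : v 2 = 0 := by
    rcases h1 with h1 | h1
    · simp [h1] at h2
    · exact h1
  simp [hv] at h3 h5
  tauto

theorem famB5 : pJ (famB (0 : F) 0 1) ∧ pJJ (famB (0 : F) 0 1) := by
  constructor
  · refine ⟨![1, 0, 0, 0], ![0, 1, 0, 0], ?_, ?_⟩ <;> simp [famB_zero]
  · refine ⟨![1, 0, 0, 0], ![1, 0, 0, 0], ![0, 1, 0, 0], ![0, 1, 0, 0], ?_, ?_, ?_⟩ <;>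
      simp [famB_zero]

theorem famB6 : ¬ pJ (famB (1 : F) 0 0) ∧ pJJ (famB (1 : F) 0 0) := by
  constructor
  · rintro ⟨x, t, h1, h2⟩
    simp [famB_zero] at h1 h2
    simp [h1] at h2
  · refine ⟨![1, 0, 0, 0], ![0, 1, 0, 0], ![1, 0, 0, 0], ![0, 1, 0, 0], ?_, ?_, ?_⟩ <;>
      simp [famB_zero]

theorem famB7 (a b : F) (h : ∀ r : F, r ^ 2 ≠ a * r + b) : ¬ pJJ (famB a b 1) := by
  rintro ⟨x, y, t, s, h1, h2, h3⟩
  simp only [ne_eq, famB_zero] at h1 h2 h3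
  obtain ⟨e1, e2⟩ := h1
  by_cases hx : x 0 = 0
  · by_cases hx1 : x 1 = 0
    · simp [hx, hx1] at h2
    · simp [hx, hx1] at e1 e2
      simp [e1, e2] at h3
  · have h5 : x 0 * y 1 = -(a * x 0 + x 1) * y 0 := by linear_combination e1
    have h6 : ((x 1) ^ 2 + a * x 0 * x 1 - b * (x 0) ^ 2) * y 0 = 0 := by
      linear_combination -x 0 * e2 + x 1 * h5
    rcases mul_eq_zero.1 h6 with h7 | h7
    · apply h (-(x 1 / x 0))
      field_simp
      linear_combination h7
    · have : y 1 = 0 := by simpa [h7, hx] using h5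
      simp [h7, this] at h3

theorem famC_nT3 (d : F) : ¬ pT3 (famC d) := by
  intro H
  have := H ![1, 0, 0, 0] ![1, 0, 0, 0] ![1, 0, 0, 0]
  simp [famC_mul] at this

theorem famC_nZ (d : F) : ¬ pZ (famC d) := by
  intro H
  have := H ![1, 0, 0, 0] ![1, 0, 0, 0]
  simp [famC_mul] at this

theorem famC_T4 (d : F) : pT4 (famC d) := by
  intro x y z w
  simp [famC_mul]

theorem famC_nL : ¬ pL (famC (0 : F)) := by
  rintro ⟨v, H⟩
  obtain ⟨k, hk⟩ := H ![0, 1, 0, 0] (by intro t; simp [famC_zero])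
  obtain ⟨l, hl⟩ := H ![0, 0, 0, 1] (by intro t; simp [famC_zero])
  have h1 := congrFun hk 1
  have h2 := congrFun hk 3
  have h3 := congrFun hl 1
  have h4 := congrFun hl 3
  simp at h1 h2 h3 h4
  grind

theorem famC_L : pL (famC (1 : F)) := by
  refine ⟨![0, 0, 0, 1], fun x hx => ⟨x 3, ?_⟩⟩
  have h1 := hx ![1, 0, 0, 0]
  have h2 := hx ![0, 1, 0, 0]
  simp [famC_zero] at h1 h2
  ext i
  fin_cases i <;> simp [h1, h2]

theorem famD_nT4 : ¬ pT4 (famD F) := by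
  intro H
  have := H ![1, 0, 0, 0] ![1, 0, 0, 0] ![1, 0, 0, 0] ![1, 0, 0, 0]
  simp [famD_mul] at this

theorem famD_nZ : ¬ pZ (famD F) := by
  intro H
  have := H ![1, 0, 0, 0] ![1, 0, 0, 0]
  simp [famD_mul] at this

def rep (ε α β : F) : Fin 12 → CommNilpAlgStr F 4 :=
  ![famA 0 0 0 0, famA 1 0 0 0, famA 0 1 0 0, famA 1 0 (-ε) 0, famA 0 1 0 1, famB 0 0 1,
    famB 1 0 0, famB α β 1, famC 0, famC 1, famD F, famA 1 0 1 1]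

theorem code_rep {ε α β : F} {S : Prop} (h : FieldHyp ε α β S) (i : Fin 12) (hi : i = 11 → S) :
    code (rep ε α β i) = i := by
  fin_cases i
  · change code (famA 0 0 0 0) = 0
    have : pZ (famA (0 : F) 0 0 0) := by intro x y; simp [famA_mul]
    simp [code, this]
  · change code (famA 1 0 0 0) = 1
    simp [code, famA_nZ, famA_T3, famA_T4, famA_K, famA_M]
  · change code (famA 0 1 0 0) = 2
    have := famA_nM (0 : F) 1 0 0 (by simp)
    have := famA_I (0 : F)
    simp [code, famA_nZ, famA_T3, famA_T4, famA_K, famA_nL, *]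
  · change code (famA 1 0 (-ε) 0) = 3
    have := famA_nM (1 : F) 0 (-ε) 0 (by simpa using h.e0)
    have := famA_nI2 (-ε) h.e1
    simp [code, famA_nZ, famA_T3, famA_T4, famA_K, famA_nL, *]
  · change code (famA 0 1 0 1) = 4
    have := famA_nM (0 : F) 1 0 1 (by simp)
    have := famA_L (0 : F) 1 0 1 (by simp) one_ne_zero
    have := famA_I (1 : F)
    simp [code, famA_nZ, famA_T3, famA_T4, famA_K, *]
  · change code (famB 0 0 1) = 5
    simp [code, famB_nZ, famB_T3, famB_T4, famB_nK, famB5]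
  · change code (famB 1 0 0) = 6
    simp [code, famB_nZ, famB_T3, famB_T4, famB_nK, famB6]
  · change code (famB α β 1) = 7
    simp [code, famB_nZ, famB_T3, famB_T4, famB_nK, famB7 α β h.q1]
  · change code (famC 0) = 8
    simp [code, famC_nZ, famC_nT3, famC_T4, famC_nL]
  · change code (famC 1) = 9
    simp [code, famC_nZ, famC_nT3, famC_T4, famC_L]
  · change code (famD F) = 10
    simp [code, famD_nZ, famD_nT4]
  · change code (famA 1 0 1 1) = 11
    have := famA_nM (1 : F) 0 1 1 (by simp)
    have := famA_L (1 : F) 0 1 1 (by simp) one_ne_zero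
    have := famA_nI3 (h.hS (hi rfl))
    simp [code, famA_nZ, famA_T3, famA_T4, famA_K, *]

theorem classify {ε α β : F} {S : Prop} (h : FieldHyp ε α β S) (P : CommNilpAlgStr F 4) :
    ∃ i : Fin 12, (i = 11 → S) ∧ P.Iso (rep ε α β i) := by
  have hd := alg_finrank P
  have hn := alg_nil P
  by_cases hz : ∃ x y : Alg P, x * y ≠ 0
  swap
  · push Not at hz
    refine ⟨0, by simp, LinearEquiv.refl F _, fun x y => ?_⟩
    have : P.mul x y = 0 := hz x y
    change P.mul x y = (famA 0 0 0 0).mul x y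
    rw [this, famA_mul]
    ext i
    fin_cases i <;> simp
  by_cases h4 : ∃ x y z w : Alg P, x * y * z * w ≠ 0
  · exact ⟨10, by simp, (caseD hd hn h4).iso⟩
  push Not at h4
  by_cases h3 : ∃ x y z : Alg P, x * y * z ≠ 0
  · rcases caseC hd hn h4 h3 with hc | hc
    · exact ⟨8, by simp, hc.iso⟩
    · exact ⟨9, by simp, hc.iso⟩
  push Not at h3
  by_cases hK : ∃ v : Alg P, ∀ x y : Alg P, ∃ c : F, x * y = c • v
  · rcases caseA hd h3 hK hz ε S h.he h.hr with hc | hc | hc | hc | ⟨hS, hc⟩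
    · exact ⟨1, by simp, hc.iso⟩
    · exact ⟨2, by simp, hc.iso⟩
    · exact ⟨3, by simp, hc.iso⟩
    · exact ⟨4, by simp, hc.iso⟩
    · exact ⟨11, fun _ => hS, hc.iso⟩
  · rcases caseB hd h3 hK α β h.hq with hc | hc | hc
    · exact ⟨5, by simp, hc.iso⟩
    · exact ⟨6, by simp, hc.iso⟩
    · exact ⟨7, by simp, hc.iso⟩

theorem count {ε α β : F} {S : Prop} (h : FieldHyp ε α β S) (n : ℕ) (hn : n ≤ 12)
    (hS : ∀ i : Fin 12, (i = 11 → S) ↔ (i : ℕ) < n) :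
    Nat.card (Quot (@CommNilpAlgStr.Iso F _ 4)) = n := by
  let f : Fin n → Quot (@CommNilpAlgStr.Iso F _ 4) := fun i =>
    Quot.mk _ (rep ε α β (Fin.castLE hn i))
  have hf : Function.Bijective f := by
    constructor
    · intro i j hij
      have := congrArg (Quot.lift code (fun _ _ => code_congr)) hij
      change code (rep ε α β (Fin.castLE hn i)) = code (rep ε α β (Fin.castLE hn j)) at this
      rw [code_rep h _ ((hS _).2 i.2), code_rep h _ ((hS _).2 j.2)] at this
      exact Fin.ext this
    · intro q
      induction q using Quot.ind with
      | mk P =>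
        obtain ⟨i, hi, hP⟩ := classify h P
        exact ⟨⟨i, (hS i).1 hi⟩, (Quot.sound hP).symm⟩
  rw [← Nat.card_eq_of_bijective f hf]
  simp

end Inv

end NilAlg

/-- Over `ℝ` there are exactly 12 isomorphism classes of 4-dimensional commutative
nilpotent non-unital associative algebras, and over any finite field there are
exactly 11. -/
theorem stmt19 :
    Nat.card (Quot (@CommNilpAlgStr.Iso ℝ _ 4)) = 12 ∧
    ∀ (F : Type) [Field F] [Fintype F],
      Nat.card (Quot (@CommNilpAlgStr.Iso F _ 4)) = 11 := by
  constructor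
  · exact NilAlg.count NilAlg.fieldHyp_real 12 le_rfl (by decide)
  · intro F _ _
    by_cases h2 : ringChar F = 2
    · obtain ⟨β, h⟩ := NilAlg.fieldHyp_even F h2
      exact NilAlg.count h 11 (by norm_num) (by decide)
    · obtain ⟨ε, h⟩ := NilAlg.fieldHyp_odd F h2
      exact NilAlg.count h 11 (by norm_num) (by decide)
end
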